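/- arXiv:1807.05376 — 3 statements merged into one kernel-verified Lean document; each statement's English description precedes it below -/
import Mathlib

section
/- Let (G,p) be a generic framework in dimension 2. Then (G,p) is rigid and ceases to be rigid after removing any single edge if and only if G has n vertices, exactly 2n−3 edges, and every set of n' ≥ 2 vertices induces at most 2n'−3 edges. (Laman's Theorem) -/
open scoped RealInnerProductSpace

namespace CoordRigidity

variable {V : Type*} [Fintype V] [DecidableEq V] {d k : ℕ}

abbrev Cfg (V : Type*) (d : ℕ) := V → EuclideanSpace ℝ (Fin d)

/-- `p` is generic: its `d|V|` coordinates are algebraically independent over `ℚ`. -/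
def Generic (p : Cfg V d) : Prop :=
  AlgebraicIndependent ℚ (fun vi : V × Fin d => p vi.1 vi.2)

def FrameworkEquiv (G : SimpleGraph V) (p q : Cfg V d) : Prop :=
  ∀ i j, G.Adj i j → dist (p i) (p j) = dist (q i) (q j)

def Congruent (p q : Cfg V d) : Prop :=
  ∃ T : EuclideanSpace ℝ (Fin d) ≃ᵢ EuclideanSpace ℝ (Fin d), ∀ v, q v = T (p v)

def Rigid (G : SimpleGraph V) (p : Cfg V d) : Prop :=
  ∃ U ∈ nhds p, ∀ q ∈ U, FrameworkEquiv G p q → Congruent p q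

def IsInfMotion (G : SimpleGraph V) (p p' : Cfg V d) : Prop :=
  ∀ i j, G.Adj i j → ⟪p j - p i, p' j - p' i⟫ = 0

def IsTrivialMotion (p p' : Cfg V d) : Prop :=
  ∃ (S : Matrix (Fin d) (Fin d) ℝ) (t : Fin d → ℝ),
    S.transpose = -S ∧ ∀ v i, p' v i = (∑ j, S i j * p v j) + t i

def InfRigid (G : SimpleGraph V) (p : Cfg V d) : Prop :=
  ∀ p', IsInfMotion G p p' → IsTrivialMotion p p'

def FiniteMotion (G : SimpleGraph V) (p : Cfg V d) (P : ℝ → Cfg V d) : Prop :=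
  ContinuousOn P (Set.Ico 0 1) ∧ P 0 = p ∧
    ∀ t ∈ Set.Ico (0:ℝ) 1, FrameworkEquiv G p (P t)

def Flexible (G : SimpleGraph V) (p : Cfg V d) : Prop :=
  ∃ P, FiniteMotion G p P ∧ ∃ t ∈ Set.Ico (0:ℝ) 1, ¬ Congruent p (P t)

def IsEquilibriumLoad (p f : Cfg V d) : Prop :=
  (∑ i, f i) = 0 ∧
  ∀ j k : Fin d, j < k → (∑ i, (f i j * p i k - f i k * p i j)) = 0

def Resolves (G : SimpleGraph V) [DecidableRel G.Adj] (p : Cfg V d)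
    (ρ : Sym2 V → ℝ) (f : Cfg V d) : Prop :=
  ∀ i, (∑ j, if G.Adj i j then ρ s(i,j) • (p j - p i) else 0) = -f i

def IsEquilibriumStress (G : SimpleGraph V) [DecidableRel G.Adj] (p : Cfg V d)
    (ω : Sym2 V → ℝ) : Prop :=
  ∀ i, (∑ j, if G.Adj i j then ω s(i,j) • (p j - p i) else 0) = (0 : EuclideanSpace ℝ (Fin d))

/-- The row of the rigidity matrix corresponding to an edge. -/
noncomputable def rRow (p : Cfg V d) : Sym2 V → (V × Fin d → ℝ) :=
  Sym2.lift ⟨fun i j vk =>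
      (if vk.1 = i then p i vk.2 - p j vk.2 else 0) +
      (if vk.1 = j then p j vk.2 - p i vk.2 else 0),
    fun _ _ => funext fun _ => add_comm _ _⟩

noncomputable def coordRow (c : Sym2 V → Option (Fin k)) (p : Cfg V d) (e : Sym2 V) :
    (V × Fin d) ⊕ Fin k → ℝ :=
  Sum.elim (rRow p e) (fun ℓ => if c e = some ℓ then 1 else 0)

noncomputable def rowRank (p : Cfg V d) (F : Set (Sym2 V)) : ℕ :=
  Module.finrank ℝ ↥(Submodule.span ℝ (rRow p '' F))

def CoordEquiv (G : SimpleGraph V) (c : Sym2 V → Option (Fin k))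
    (p : Cfg V d) (r : Fin k → ℝ) (q : Cfg V d) (s : Fin k → ℝ) : Prop :=
  (∀ i j, G.Adj i j → c s(i,j) = none → dist (p i) (p j) = dist (q i) (q j)) ∧
  (∀ i j ℓ, G.Adj i j → c s(i,j) = some ℓ →
    dist (p i) (p j) + r ℓ = dist (q i) (q j) + s ℓ)

def CoordCongruent (G : SimpleGraph V) (c : Sym2 V → Option (Fin k))
    (p : Cfg V d) (r : Fin k → ℝ) (q : Cfg V d) (s : Fin k → ℝ) : Prop :=
  CoordEquiv G c p r q s ∧ Congruent p q

def CoordRigid (G : SimpleGraph V) (c : Sym2 V → Option (Fin k))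
    (p : Cfg V d) (r : Fin k → ℝ) : Prop :=
  ∃ U ∈ nhds (p, r), ∀ qs : Cfg V d × (Fin k → ℝ), qs ∈ U →
    CoordEquiv G c p r qs.1 qs.2 → CoordCongruent G c p r qs.1 qs.2

def IsCoordInfMotion (G : SimpleGraph V) (c : Sym2 V → Option (Fin k))
    (p : Cfg V d) (p' : Cfg V d) (r' : Fin k → ℝ) : Prop :=
  (∀ i j, G.Adj i j → c s(i,j) = none → ⟪p j - p i, p' j - p' i⟫ = 0) ∧
  (∀ i j ℓ, G.Adj i j → c s(i,j) = some ℓ → ⟪p j - p i, p' j - p' i⟫ + r' ℓ = 0)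

def CoordInfRigid (G : SimpleGraph V) (c : Sym2 V → Option (Fin k)) (p : Cfg V d) : Prop :=
  ∀ p' r', IsCoordInfMotion G c p p' r' → r' = 0 ∧ IsTrivialMotion p p'

def CoordFiniteMotion (G : SimpleGraph V) (c : Sym2 V → Option (Fin k))
    (p : Cfg V d) (r : Fin k → ℝ) (P : ℝ → Cfg V d) (R : ℝ → (Fin k → ℝ)) : Prop :=
  ContinuousOn (fun t => (P t, R t)) (Set.Ico 0 1) ∧ P 0 = p ∧ R 0 = r ∧
    ∀ t ∈ Set.Ico (0:ℝ) 1, CoordEquiv G c p r (P t) (R t)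

def CoordFlexible (G : SimpleGraph V) (c : Sym2 V → Option (Fin k))
    (p : Cfg V d) (r : Fin k → ℝ) : Prop :=
  ∃ P R, CoordFiniteMotion G c p r P R ∧
    ∃ t ∈ Set.Ico (0:ℝ) 1, ¬ CoordCongruent G c p r (P t) (R t)

/-- Combinatorial Laman-type notions, for a "subgraph" given by a vertex set `W`
and an edge set `E'`. -/
def support (E' : Set (Sym2 V)) : Set V := {v | ∃ e ∈ E', v ∈ e}

def edgesWithin (E' : Set (Sym2 V)) (W : Set V) : Set (Sym2 V) :=
  {e ∈ E' | ∀ v ∈ e, v ∈ W}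

def LamanSparseOn (W : Set V) (E' : Set (Sym2 V)) : Prop :=
  ∀ W' ⊆ W, 2 ≤ W'.ncard → (edgesWithin E' W').ncard ≤ 2 * W'.ncard - 3

def Sparse22On (W : Set V) (E' : Set (Sym2 V)) : Prop :=
  ∀ W' ⊆ W, 2 ≤ W'.ncard → (edgesWithin E' W').ncard ≤ 2 * W'.ncard - 2

def IsLamanOn (W : Set V) (E' : Set (Sym2 V)) : Prop :=
  LamanSparseOn W E' ∧ E'.ncard = 2 * W.ncard - 3

def IsLamanCircuitOn (W : Set V) (E' : Set (Sym2 V)) : Prop :=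
  E'.ncard = 2 * W.ncard - 2 ∧ ∀ e ∈ E', IsLamanOn W (E' \ {e})

def IsLamanPlusOne (G : SimpleGraph V) : Prop :=
  G.edgeSet.ncard = 2 * Fintype.card V - 2 ∧
    ∃ e ∈ G.edgeSet, IsLamanOn Set.univ (G.edgeSet \ {e})

def IsLamanPlusTwo (G : SimpleGraph V) : Prop :=
  G.edgeSet.ncard = 2 * Fintype.card V - 1 ∧
    ∃ e ∈ G.edgeSet, ∃ f ∈ G.edgeSet, e ≠ f ∧
      IsLamanOn Set.univ (G.edgeSet \ {e, f})

/-- An edge is redundant in the generic `d`-dimensional rigidity matroid of `G`. -/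
def RedundantSet (d : ℕ) (G : SimpleGraph V) (F : Set (Sym2 V)) : Prop :=
  ∀ p : Cfg V d, Generic p → rowRank p (G.edgeSet \ F) = rowRank p G.edgeSet

open Filter Topology

set_option linter.unusedSectionVars false

theorem exists_isometryEquiv_of_dist_eq {ι E : Type*} [NormedAddCommGroup E] [InnerProductSpace ℝ E]
    [FiniteDimensional ℝ E] (p q : ι → E) (h : ∀ i j, dist (p i) (p j) = dist (q i) (q j)) :
    ∃ T : E ≃ᵢ E, ∀ i, q i = T (p i) := by
  rcases isEmpty_or_nonempty ι with hι | ⟨⟨o⟩⟩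
  · exact ⟨IsometryEquiv.refl E, fun i => isEmptyElim i⟩
  have hinner : ∀ i j, ⟪p i - p o, p j - p o⟫ = ⟪q i - q o, q j - q o⟫ := by
    intro i j
    have e1 := h i o
    have e2 := h j o
    have e3 := h i j
    simp only [dist_eq_norm] at e1 e2 e3
    rw [real_inner_eq_norm_mul_self_add_norm_mul_self_sub_norm_sub_mul_self_div_two,
      real_inner_eq_norm_mul_self_add_norm_mul_self_sub_norm_sub_mul_self_div_two]
    simp only [sub_sub_sub_cancel_right, e1, e2, e3]
  let P := Finsupp.linearCombination ℝ (fun i => p i - p o)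
  let Q := Finsupp.linearCombination ℝ (fun i => q i - q o)
  have hPQ : ∀ c, ‖P c‖ = ‖Q c‖ := by
    intro c
    rw [← sq_eq_sq₀ (norm_nonneg _) (norm_nonneg _), ← real_inner_self_eq_norm_sq,
      ← real_inner_self_eq_norm_sq]
    simp only [P, Q, Finsupp.linearCombination_apply, Finsupp.sum, sum_inner, inner_sum,
      real_inner_smul_left, real_inner_smul_right, hinner]
  have hker : P.ker ≤ Q.ker := fun c hc => by
    have := hPQ c
    rw [LinearMap.mem_ker.1 hc, norm_zero] at this
    exact norm_eq_zero.1 this.symm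
  obtain ⟨s, hs⟩ := P.rangeRestrict.exists_rightInverse_of_surjective P.range_rangeRestrict
  have hsP : ∀ y : P.range, P (s y) = y := fun y =>
    congrArg Subtype.val (DFunLike.congr_fun hs y)
  let L : P.range →ₗᵢ[ℝ] E := ⟨Q.comp s, fun y => by
    rw [LinearMap.comp_apply, ← hPQ, hsP]; rfl⟩
  let T := L.extend.toLinearIsometryEquiv rfl
  have hT : ∀ i, T (p i - p o) = q i - q o := by
    intro i
    have hm : P (Finsupp.single i 1) = p i - p o := by simp [P]
    have hm' : Q (Finsupp.single i 1) = q i - q o := by simp [Q]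
    have e1 : T (p i - p o) = Q (s ⟨p i - p o, hm ▸ P.mem_range_self _⟩) :=
      L.extend_apply ⟨p i - p o, hm ▸ P.mem_range_self _⟩
    refine (e1.trans ?_).trans hm'
    rw [← sub_eq_zero, ← map_sub]
    apply LinearMap.mem_ker.1
    apply hker
    rw [LinearMap.mem_ker, map_sub, hsP]
    exact sub_eq_zero.2 hm.symm
  refine ⟨((IsometryEquiv.addRight (-p o)).trans T.toIsometryEquiv).trans
    (IsometryEquiv.addRight (q o)), fun i => ?_⟩
  have := hT i
  simp only [IsometryEquiv.trans_apply, IsometryEquiv.addRight_apply,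
    LinearIsometryEquiv.coe_toIsometryEquiv, ← sub_eq_add_neg, this, sub_add_cancel]

/-- If the derivative of `g` vanishes on the kernel of the derivative of `F` throughout a
neighbourhood of a point where `F` is a submersion, then `g` is constant along the fibre of `F`
through that point, locally. -/
theorem eventually_eq_of_ker_fderiv_le {X Y : Type*} [NormedAddCommGroup X] [NormedSpace ℝ X]
    [FiniteDimensional ℝ X] [NormedAddCommGroup Y] [NormedSpace ℝ Y] [FiniteDimensional ℝ Y]
    {F : X → Y} {g : X → ℝ} {a : X} (hF : ContDiff ℝ 1 F) (hg : ContDiff ℝ 1 g)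
    (hsurj : Function.Surjective (fderiv ℝ F a))
    (hker : ∀ᶠ x in 𝓝 a, ∀ u, fderiv ℝ F x u = 0 → fderiv ℝ g x u = 0) :
    ∀ᶠ x in 𝓝 a, F x = F a → g x = g a := by
  have := FiniteDimensional.complete ℝ X
  have := FiniteDimensional.complete ℝ Y
  obtain ⟨π, hπ⟩ := (fderiv ℝ F a).ker.exists_isCompl
  let K := (fderiv ℝ F a).ker
  let P : X →L[ℝ] K := (K.projectionOnto π hπ).toContinuousLinearMap
  have hPr : P.range = ⊤ := by
    rw [LinearMap.range_eq_top]
    intro z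
    exact ⟨z, K.projectionOnto_apply_left hπ z⟩
  have hFr : (fderiv ℝ F a).range = ⊤ := LinearMap.range_eq_top.2 hsurj
  have hc : IsCompl (fderiv ℝ F a).ker P.ker := by
    have : P.ker = π := K.ker_projectionOnto hπ
    rw [this]; exact hπ
  let e := (fderiv ℝ F a).equivProdOfSurjectiveOfIsCompl P hFr hPr hc
  let Φ : X → Y × K := fun x => (F x, P x)
  have hΦ : ContDiff ℝ 1 Φ := hF.prodMk P.contDiff
  have hΦ' : HasFDerivAt Φ (e : X →L[ℝ] Y × K) a :=
    ((hF.differentiable one_ne_zero).differentiableAt.hasFDerivAt).prodMk P.hasFDerivAt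
  have hs := hΦ.contDiffAt.hasStrictFDerivAt' hΦ' one_ne_zero
  let ψ := hs.localInverse Φ e a
  have hψ : ContDiffAt ℝ 1 ψ (Φ a) := hΦ.contDiffAt.to_localInverse hΦ' one_ne_zero
  have hψa : ψ (Φ a) = a := hs.localInverse_apply_image
  have h1 : ∀ᶠ y in 𝓝 (Φ a), ContDiffAt ℝ 1 ψ y := hψ.eventually (by simp)
  have h2 : ∀ᶠ y in 𝓝 (Φ a), ∀ᶠ y' in 𝓝 y, Φ (ψ y') = y' := hs.eventually_right_inverse.eventually_nhds
  have h3 : ∀ᶠ y in 𝓝 (Φ a), ∀ u, fderiv ℝ F (ψ y) u = 0 → fderiv ℝ g (ψ y) u = 0 := by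
    have := hψ.continuousAt
    rw [ContinuousAt, hψa] at this
    exact this.eventually hker
  have h4 : ∀ᶠ z in 𝓝 (P a), ContDiffAt ℝ 1 ψ (F a, z) ∧ (∀ᶠ y' in 𝓝 (F a, z), Φ (ψ y') = y') ∧
      ∀ u, fderiv ℝ F (ψ (F a, z)) u = 0 → fderiv ℝ g (ψ (F a, z)) u = 0 := by
    have : Tendsto (fun z : K => (F a, z)) (𝓝 (P a)) (𝓝 (F a, P a)) :=
      (Continuous.prodMk continuous_const continuous_id).tendsto _
    exact this.eventually (h1.and (h2.and h3))
  obtain ⟨r, hr, hball⟩ := Metric.eventually_nhds_iff_ball.1 h4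
  have hd : ∀ z ∈ Metric.ball (P a) r, HasFDerivAt (fun z => g (ψ (F a, z))) (0 : K →L[ℝ] ℝ) z := by
    intro z hz
    obtain ⟨c1, c2, c3⟩ := hball z hz
    have d1 : HasFDerivAt (fun z : K => ψ (F a, z))
        ((fderiv ℝ ψ (F a, z)).comp (ContinuousLinearMap.inr ℝ Y K)) z :=
      HasFDerivAt.comp z (f := fun z : K => (F a, z)) (g := ψ)
        (c1.differentiableAt one_ne_zero).hasFDerivAt
        (hasFDerivAt_prodMk_right (F a) z)
    have d2 : HasFDerivAt (fun z : K => F (ψ (F a, z))) _ z :=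
      HasFDerivAt.comp z (g := F) (hF.differentiable one_ne_zero _).hasFDerivAt d1
    have d3 : HasFDerivAt (fun z : K => g (ψ (F a, z))) _ z :=
      HasFDerivAt.comp z (g := g) (hg.differentiable one_ne_zero _).hasFDerivAt d1
    have ev : (fun z : K => F (ψ (F a, z))) =ᶠ[𝓝 z] fun _ => F a := by
      have : Tendsto (fun z : K => (F a, z)) (𝓝 z) (𝓝 (F a, z)) :=
        (Continuous.prodMk continuous_const continuous_id).tendsto _
      filter_upwards [this.eventually c2] with w hw
      exact congrArg Prod.fst hw
    have d4 := d2.unique ((hasFDerivAt_const (F a) z).congr_of_eventuallyEq ev)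
    exact d3.congr_fderiv (ContinuousLinearMap.ext fun u => c3 _ (DFunLike.congr_fun d4 u))
  have hconst : ∀ z ∈ Metric.ball (P a) r, g (ψ (F a, z)) = g (ψ (F a, P a)) := by
    intro z hz
    refine Metric.isOpen_ball.is_const_of_fderiv_eq_zero (𝕜 := ℝ)
      (convex_ball _ _).isPreconnected
      (fun w hw => (hd w hw).differentiableAt.differentiableWithinAt)
      (fun w hw => (hd w hw).fderiv) hz (Metric.mem_ball_self hr)
  filter_upwards [hs.eventually_left_inverse,
    P.continuous.continuousAt.eventually (Metric.ball_mem_nhds (P a) hr)] with x hx hx2 hFx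
  have e1 : ψ (F a, P x) = x := by rw [← hFx]; exact hx
  have e2 := hconst _ hx2
  rw [e1] at e2
  rw [e2]
  exact congrArg g hψa

/-- The first-order change of the squared length of the edge `e` of the framework `q` under the
velocities `u`, up to a factor of two. -/
noncomputable def edgeForm (q u : Cfg V d) : Sym2 V → ℝ :=
  Sym2.lift ⟨fun i j => ⟪q i - q j, u i - u j⟫, fun i j => by
    simp only [← neg_sub (q j), ← neg_sub (u j), inner_neg_neg]⟩

theorem edgeForm_mk (q u : Cfg V d) (i j : V) :
    edgeForm q u s(i, j) = ⟪q i - q j, u i - u j⟫ := rfl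

theorem edgeForm_add (q u w : Cfg V d) (e : Sym2 V) :
    edgeForm q (u + w) e = edgeForm q u e + edgeForm q w e := by
  induction e with | _ i j =>
  simp only [edgeForm_mk, Pi.add_apply, add_sub_add_comm, inner_add_right]

theorem edgeForm_smul (q u : Cfg V d) (c : ℝ) (e : Sym2 V) :
    edgeForm q (c • u) e = c * edgeForm q u e := by
  induction e with | _ i j =>
  simp only [edgeForm_mk, Pi.smul_apply, ← smul_sub, real_inner_smul_right]

theorem edgeForm_self (q : Cfg V d) (i j : V) : edgeForm q q s(i, j) = dist (q i) (q j) ^ 2 := by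
  rw [edgeForm_mk, real_inner_self_eq_norm_sq, dist_eq_norm]

theorem edgeForm_congr {q u q' u' : Cfg V d} {e : Sym2 V} (hq : ∀ v ∈ e, q v = q' v)
    (hu : ∀ v ∈ e, u v = u' v) : edgeForm q u e = edgeForm q' u' e := by
  induction e with | _ i j =>
  simp only [Sym2.mem_iff, forall_eq_or_imp, forall_eq] at hq hu
  simp only [edgeForm_mk, hq, hu]

/-- The edge set `E` is independent in the framework `q`: the edge lengths can be varied
independently to first order. -/
def Independent (q : Cfg V d) (E : Finset (Sym2 V)) : Prop :=
  ∀ t : Sym2 V → ℝ, ∃ u : Cfg V d, ∀ e ∈ E, edgeForm q u e = t e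

theorem Independent.mono {q : Cfg V d} {E F : Finset (Sym2 V)} (h : Independent q F) (hEF : E ⊆ F) :
    Independent q E := fun t =>
  let ⟨u, hu⟩ := h t
  ⟨u, fun e he => hu e (hEF he)⟩

/-- Every first-order flex of `E` preserves the length of `e` to first order. -/
def InClosure (q : Cfg V d) (E : Finset (Sym2 V)) (e : Sym2 V) : Prop :=
  ∀ u : Cfg V d, (∀ f ∈ E, edgeForm q u f = 0) → edgeForm q u e = 0

theorem inClosure_of_mem {q : Cfg V d} {E : Finset (Sym2 V)} {e : Sym2 V} (he : e ∈ E) :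
    InClosure q E e := fun _ hu => hu e he

theorem InClosure.trans {q : Cfg V d} {E F : Finset (Sym2 V)} {e : Sym2 V} (he : InClosure q F e)
    (hF : ∀ f ∈ F, InClosure q E f) : InClosure q E e :=
  fun u hu => he u fun f hf => hF f hf u hu

theorem independent_insert {q : Cfg V d} {E : Finset (Sym2 V)} {e : Sym2 V}
    (hE : Independent q E) (he : ¬ InClosure q E e) : Independent q (insert e E) := by
  intro t
  obtain ⟨u, hu⟩ := hE t
  simp only [InClosure, not_forall] at he
  obtain ⟨w, hw, hwe⟩ := he
  refine ⟨u + ((t e - edgeForm q u e) / edgeForm q w e) • w, fun f hf => ?_⟩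
  rw [edgeForm_add, edgeForm_smul]
  rcases Finset.mem_insert.1 hf with rfl | hf
  · field_simp; ring
  · rw [hw f hf, hu f hf]; ring

theorem not_inClosure_of_independent_insert {q : Cfg V d} {E : Finset (Sym2 V)} {e : Sym2 V}
    (he : e ∉ E) (h : Independent q (insert e E)) : ¬ InClosure q E e := by
  intro hc
  obtain ⟨u, hu⟩ := h (fun f => if f = e then 1 else 0)
  have h0 := hc u fun f hf => by
    rw [hu f (Finset.mem_insert_of_mem hf), if_neg (ne_of_mem_of_not_mem hf he)]
  rw [hu e (Finset.mem_insert_self _ _), if_pos rfl] at h0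
  exact one_ne_zero h0

theorem exists_independent_subset_closure (q : Cfg V d) (E : Finset (Sym2 V)) :
    ∃ F ⊆ E, Independent q F ∧ ∀ e ∈ E, InClosure q F e := by
  classical
  have hne : (E.powerset.filter (Independent q)).Nonempty :=
    ⟨∅, by simp [Independent]⟩
  obtain ⟨F, hF, hmax⟩ := Finset.exists_max_image _ Finset.card hne
  simp only [Finset.mem_filter, Finset.mem_powerset] at hF hmax
  refine ⟨F, hF.1, hF.2, fun e he => ?_⟩
  by_contra hc
  have he' : e ∉ F := fun h => hc (inClosure_of_mem h)
  have := hmax (insert e F) ⟨Finset.insert_subset he hF.1, independent_insert hF.2 hc⟩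
  rw [Finset.card_insert_of_notMem he'] at this
  omega

/-- The rigidity matrix over an arbitrary coefficient ring. -/
def rigidityMatrix {A : Type*} [CommRing A] (x : V × Fin d → A) (E : Finset (Sym2 V)) :
    Matrix E (V × Fin d) A :=
  fun e => Sym2.lift ⟨fun i j vk =>
      (if vk.1 = i then x (i, vk.2) - x (j, vk.2) else 0) +
      (if vk.1 = j then x (j, vk.2) - x (i, vk.2) else 0),
    fun _ _ => funext fun _ => add_comm _ _⟩ e.1

theorem rigidityMatrix_map {A B : Type*} [CommRing A] [CommRing B] (φ : A →+* B)
    (x : V × Fin d → A) (E : Finset (Sym2 V)) :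
    (rigidityMatrix x E).map φ = rigidityMatrix (fun vk => φ (x vk)) E := by
  ext ⟨e, he⟩ vk
  induction e with | _ i j =>
  simp [rigidityMatrix, apply_ite φ]

/-- The coordinates of a configuration. -/
def coords (q : Cfg V d) : V × Fin d → ℝ := fun vk => q vk.1 vk.2

theorem rigidityMatrix_mulVec (q u : Cfg V d) (E : Finset (Sym2 V)) (e : E) :
    (rigidityMatrix (coords q) E).mulVec (coords u) e = edgeForm q u e := by
  obtain ⟨e, he⟩ := e
  induction e with | _ i j =>
  simp only [Matrix.mulVec, dotProduct, rigidityMatrix, Sym2.lift_mk, coords, edgeForm_mk,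
    Fintype.sum_prod_type_right, add_mul, ite_mul, zero_mul, Finset.sum_add_distrib,
    Finset.sum_ite_eq', Finset.mem_univ, if_true, PiLp.inner_apply, PiLp.sub_apply]
  rw [← Finset.sum_add_distrib]
  refine Finset.sum_congr rfl fun k _ => ?_
  simp
  ring

theorem independent_iff_det_ne_zero (q : Cfg V d) (E : Finset (Sym2 V)) :
    Independent q E ↔
      (rigidityMatrix (coords q) E * (rigidityMatrix (coords q) E).transpose).det ≠ 0 := by
  set R := rigidityMatrix (coords q) E with hR
  constructor
  · intro h h0
    obtain ⟨v, hv, hv0⟩ := Matrix.exists_mulVec_eq_zero_iff.2 h0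
    obtain ⟨u, hu⟩ := h fun e => if he : e ∈ E then v ⟨e, he⟩ else 0
    have hRu : R.mulVec (coords u) = v := by
      ext e
      rw [hR, rigidityMatrix_mulVec, hu e e.2, dif_pos e.2]
    have h1 : R.transpose.mulVec v = 0 := by
      rw [← dotProduct_self_eq_zero, Matrix.dotProduct_mulVec, Matrix.vecMul_transpose,
        Matrix.mulVec_mulVec, hv0, zero_dotProduct]
    apply hv
    rw [← dotProduct_self_eq_zero]
    nth_rewrite 2 [← hRu]
    rw [Matrix.dotProduct_mulVec, ← Matrix.mulVec_transpose, h1, zero_dotProduct]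
  · intro h t
    have hu : IsUnit (R * R.transpose).det := isUnit_iff_ne_zero.2 h
    let x := R.transpose.mulVec ((R * R.transpose)⁻¹.mulVec fun e => t e)
    refine ⟨fun v => WithLp.toLp 2 fun k => x (v, k), fun e he => ?_⟩
    have := rigidityMatrix_mulVec q (fun v => WithLp.toLp 2 fun k => x (v, k)) E ⟨e, he⟩
    rw [← this]
    change R.mulVec x _ = _
    simp only [x]
    rw [Matrix.mulVec_mulVec, Matrix.mulVec_mulVec, Matrix.mul_nonsing_inv _ hu, Matrix.one_mulVec]

theorem Generic.eval_ne_zero {p : Cfg V d} (hp : Generic p) (P : MvPolynomial (V × Fin d) ℚ)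
    {q : Cfg V d} (hq : MvPolynomial.aeval (coords q) P ≠ 0) :
    MvPolynomial.aeval (coords p) P ≠ 0 := by
  intro h
  have h0 := (algebraicIndependent_iff.1 hp) P h
  rw [h0, map_zero] at hq
  exact hq rfl

/-- Generic configurations realise every independence that occurs in some configuration. -/
theorem Generic.independent {p : Cfg V d} (hp : Generic p) {q : Cfg V d} {E : Finset (Sym2 V)}
    (hq : Independent q E) : Independent p E := by
  let M := rigidityMatrix (MvPolynomial.X (R := ℚ) (σ := V × Fin d)) E
  have hM : ∀ q : Cfg V d, MvPolynomial.aeval (coords q) (M * M.transpose).det =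
      (rigidityMatrix (coords q) E * (rigidityMatrix (coords q) E).transpose).det := by
    intro q
    have h1 := rigidityMatrix_map (MvPolynomial.aeval (R := ℚ) (coords q)).toRingHom
      (MvPolynomial.X (R := ℚ) (σ := V × Fin d)) E
    have h2 : (fun vk => (MvPolynomial.aeval (R := ℚ) (coords q)).toRingHom (MvPolynomial.X vk)) =
        coords q := funext fun vk => MvPolynomial.aeval_X _ _
    rw [h2] at h1
    have := RingHom.map_det (MvPolynomial.aeval (R := ℚ) (coords q)).toRingHom (M * M.transpose)
    refine this.trans ?_
    rw [RingHom.mapMatrix_apply, Matrix.map_mul, Matrix.transpose_map, h1]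
  rw [independent_iff_det_ne_zero, ← hM] at hq ⊢
  exact hp.eval_ne_zero _ hq

theorem Independent.eventually {q : Cfg V d} {E : Finset (Sym2 V)} (h : Independent q E) :
    ∀ᶠ q' in 𝓝 q, Independent q' E := by
  simp only [independent_iff_det_ne_zero] at h ⊢
  have hc : Continuous fun q' : Cfg V d =>
      (rigidityMatrix (coords q') E * (rigidityMatrix (coords q') E).transpose).det := by
    have : Continuous fun q' : Cfg V d => rigidityMatrix (coords q') E := by
      refine continuous_matrix fun e vk => ?_
      obtain ⟨e, he⟩ := e
      induction e with | _ i j =>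
      simp only [rigidityMatrix, Sym2.lift_mk, coords]
      split_ifs <;> fun_prop
    exact (this.matrix_mul this.matrix_transpose).matrix_det
  exact hc.continuousAt.eventually_ne h

theorem Generic.inClosure_eventually {p : Cfg V d} (hp : Generic p) {E : Finset (Sym2 V)}
    (hE : Independent p E) {e : Sym2 V} (he : InClosure p E e) :
    ∀ᶠ q in 𝓝 p, InClosure q E e := by
  by_cases hmem : e ∈ E
  · exact Eventually.of_forall fun q => inClosure_of_mem hmem
  filter_upwards [hE.eventually] with q hq
  by_contra hc
  exact not_inClosure_of_independent_insert hmem (hp.independent (independent_insert hq hc)) he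

theorem contDiff_edgeForm_self (e : Sym2 V) : ContDiff ℝ 1 fun q : Cfg V d => edgeForm q q e := by
  induction e with | _ i j =>
  simp only [edgeForm_mk]
  exact ContDiff.inner ℝ (by fun_prop) (by fun_prop)

theorem fderiv_edgeForm_self (q u : Cfg V d) (e : Sym2 V) :
    fderiv ℝ (fun q : Cfg V d => edgeForm q q e) q u = 2 * edgeForm q u e := by
  induction e with | _ i j =>
  simp only [edgeForm_mk]
  have h : HasFDerivAt (fun q : Cfg V d => q i - q j)
      (ContinuousLinearMap.proj (R := ℝ) (φ := fun _ : V => EuclideanSpace ℝ (Fin d)) i -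
        ContinuousLinearMap.proj j) q :=
    (hasFDerivAt_apply i q).sub (hasFDerivAt_apply j q)
  rw [(h.inner ℝ h).fderiv]
  simp [fderivInnerCLM_apply, real_inner_comm, two_mul]

/-- The squared lengths of the edges in `E`. -/
noncomputable def sqLengths (E : Finset (Sym2 V)) (q : Cfg V d) : E → ℝ := fun e => edgeForm q q e

theorem contDiff_sqLengths (E : Finset (Sym2 V)) :
    ContDiff ℝ 1 (sqLengths E : Cfg V d → E → ℝ) :=
  contDiff_pi.2 fun e => contDiff_edgeForm_self e.1

theorem fderiv_sqLengths (E : Finset (Sym2 V)) (q u : Cfg V d) (e : E) :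
    fderiv ℝ (sqLengths E) q u e = 2 * edgeForm q u e := by
  have h : HasFDerivAt (sqLengths E : Cfg V d → E → ℝ) _ q :=
    hasFDerivAt_pi.2 fun e =>
      ((contDiff_edgeForm_self (d := d) e.1).differentiable one_ne_zero q).hasFDerivAt
  rw [h.fderiv]
  exact fderiv_edgeForm_self q u e.1

theorem Independent.surjective_fderiv {q : Cfg V d} {E : Finset (Sym2 V)} (h : Independent q E) :
    Function.Surjective (fderiv ℝ (sqLengths E) q) := by
  intro t
  obtain ⟨u, hu⟩ := h fun e => if he : e ∈ E then t ⟨e, he⟩ / 2 else 0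
  refine ⟨u, funext fun e => ?_⟩
  rw [fderiv_sqLengths, hu e e.2, dif_pos e.2]
  exact mul_div_cancel₀ _ two_ne_zero

theorem Generic.eventually_edgeForm_eq {p : Cfg V d} (hp : Generic p) {E : Finset (Sym2 V)}
    (hE : Independent p E) {e : Sym2 V} (he : InClosure p E e) :
    ∀ᶠ q in 𝓝 p, (∀ f ∈ E, edgeForm q q f = edgeForm p p f) → edgeForm q q e = edgeForm p p e := by
  have := eventually_eq_of_ker_fderiv_le (contDiff_sqLengths E) (contDiff_edgeForm_self (d := d) e)
    hE.surjective_fderiv (by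
      filter_upwards [hp.inClosure_eventually hE he] with q hq u hu
      rw [fderiv_edgeForm_self, hq u, mul_zero]
      intro f hf
      have := congrFun hu ⟨f, hf⟩
      rw [fderiv_sqLengths] at this
      simpa using this)
  filter_upwards [this] with q hq h
  exact hq (funext fun f => h f f.2)

theorem Independent.exists_edgeForm_ne {p : Cfg V d} {E : Finset (Sym2 V)} {e : Sym2 V}
    (he : e ∉ E) (h : Independent p (insert e E)) {U : Set (Cfg V d)} (hU : U ∈ 𝓝 p) :
    ∃ q ∈ U, (∀ f ∈ E, edgeForm q q f = edgeForm p p f) ∧ edgeForm q q e ≠ edgeForm p p e := by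
  have hs : HasStrictFDerivAt (sqLengths (insert e E)) (fderiv ℝ (sqLengths (insert e E)) p) p :=
    (contDiff_sqLengths (insert e E)).contDiffAt.hasStrictFDerivAt one_ne_zero
  have hmap := hs.map_nhds_eq_of_surj (LinearMap.range_eq_top.2 h.surjective_fderiv)
  have himg : sqLengths (insert e E) '' U ∈ 𝓝 (sqLengths (insert e E) p) := by
    rw [← hmap]
    exact image_mem_map hU
  let c : ℝ → ↥(insert e E) → ℝ := fun s f =>
    sqLengths (insert e E) p f + if f.1 = e then s else 0
  have hc : Continuous c := by
    refine continuous_pi fun f => ?_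
    by_cases hf : f.1 = e <;> simp only [c, hf, if_true, if_false] <;> fun_prop
  have hc0 : c 0 = sqLengths (insert e E) p := funext fun f => by simp [c]
  have hev : ∀ᶠ s in 𝓝[≠] (0 : ℝ), c s ∈ sqLengths (insert e E) '' U := by
    have := (hc.tendsto 0).eventually (by rw [hc0]; exact himg)
    exact this.filter_mono nhdsWithin_le_nhds
  obtain ⟨s, ⟨q, hqU, hq⟩, hs0⟩ := (hev.and self_mem_nhdsWithin).exists
  refine ⟨q, hqU, fun f hf => ?_, ?_⟩
  · have := congrFun hq ⟨f, Finset.mem_insert_of_mem hf⟩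
    simpa [c, sqLengths, ne_of_mem_of_not_mem hf he] using this
  · have := congrFun hq ⟨e, Finset.mem_insert_self _ _⟩
    simp only [c, sqLengths, if_true] at this
    rw [this]
    simpa using hs0

theorem frameworkEquiv_iff {G : SimpleGraph V} {p q : Cfg V d} :
    FrameworkEquiv G p q ↔ ∀ e ∈ G.edgeSet, edgeForm q q e = edgeForm p p e := by
  constructor
  · intro h e he
    induction e with | _ i j =>
    rw [edgeForm_self, edgeForm_self, h i j he]
  · intro h i j hij
    have := h s(i, j) hij
    rw [edgeForm_self, edgeForm_self] at this
    exact ((sq_eq_sq₀ dist_nonneg dist_nonneg).1 this).symm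

theorem congruent_iff {p q : Cfg V d} :
    Congruent p q ↔ ∀ e : Sym2 V, edgeForm q q e = edgeForm p p e := by
  constructor
  · rintro ⟨T, hT⟩ e
    induction e with | _ i j =>
    rw [edgeForm_self, edgeForm_self, hT, hT, T.dist_eq]
  · intro h
    refine exists_isometryEquiv_of_dist_eq p q fun i j => ?_
    have := h s(i, j)
    rw [edgeForm_self, edgeForm_self] at this
    exact ((sq_eq_sq₀ dist_nonneg dist_nonneg).1 this).symm

/-- A generic framework is rigid exactly if it is infinitesimally rigid, in the sense that every
flex of its edges is a flex of the complete graph. -/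
theorem Generic.rigid_iff {p : Cfg V d} (hp : Generic p) {G : SimpleGraph V}
    {E : Finset (Sym2 V)} (hE : ∀ e, e ∈ E ↔ e ∈ G.edgeSet) :
    Rigid G p ↔ ∀ e, InClosure p E e := by
  obtain ⟨F, hFE, hF, hcl⟩ := exists_independent_subset_closure p E
  constructor
  · rintro ⟨U, hU, hrig⟩ e
    by_contra he
    have he' : ¬ InClosure p F e := fun h => he (h.trans fun f hf => inClosure_of_mem (hFE hf))
    have hev : ∀ᶠ q in 𝓝 p, ∀ f ∈ E, (∀ f ∈ F, edgeForm q q f = edgeForm p p f) →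
        edgeForm q q f = edgeForm p p f :=
      (Finset.eventually_all E).2 fun f hf => hp.eventually_edgeForm_eq hF (hcl f hf)
    obtain ⟨q, ⟨hqU, hqE⟩, hqF, hqe⟩ := (independent_insert hF he').exists_edgeForm_ne
      (fun h => he' (inClosure_of_mem h)) (inter_mem hU hev)
    exact hqe (congruent_iff.1 (hrig q hqU (frameworkEquiv_iff.2 fun f hf =>
      hqE f ((hE f).2 hf) hqF)) e)
  · intro h
    have hev : ∀ᶠ q in 𝓝 p, ∀ e, (∀ f ∈ F, edgeForm q q f = edgeForm p p f) →
        edgeForm q q e = edgeForm p p e :=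
      eventually_all.2 fun e => hp.eventually_edgeForm_eq hF ((h e).trans hcl)
    refine ⟨_, hev, fun q hq heq => congruent_iff.2 fun e => hq e fun f hf => ?_⟩
    exact frameworkEquiv_iff.1 heq f ((hE f).1 (hFE hf))

/-- The determinant of two plane vectors. -/
def cross (a b : EuclideanSpace ℝ (Fin 2)) : ℝ := a 0 * b 1 - a 1 * b 0

/-- Rotation of the plane by a quarter turn. -/
noncomputable def quarterTurn (a : EuclideanSpace ℝ (Fin 2)) : EuclideanSpace ℝ (Fin 2) :=
  !₂[-a 1, a 0]

theorem inner_fin_two (a b : EuclideanSpace ℝ (Fin 2)) : ⟪a, b⟫ = a 0 * b 0 + a 1 * b 1 := by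
  simp [PiLp.inner_apply, mul_comm]

theorem exists_inner_eq {a b : EuclideanSpace ℝ (Fin 2)} (h : cross a b ≠ 0) (s t : ℝ) :
    ∃ y : EuclideanSpace ℝ (Fin 2), ⟪a, y⟫ = s ∧ ⟪b, y⟫ = t := by
  refine ⟨!₂[(s * b 1 - t * a 1) / cross a b, (t * a 0 - s * b 0) / cross a b], ?_, ?_⟩ <;>
  · simp only [inner_fin_two, Matrix.cons_val_zero, Matrix.cons_val_one]
    field_simp
    rw [cross]
    ring

theorem eq_zero_of_inner_eq_zero {a b y : EuclideanSpace ℝ (Fin 2)} (h : cross a b ≠ 0)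
    (ha : ⟪a, y⟫ = 0) (hb : ⟪b, y⟫ = 0) : y = 0 := by
  rw [inner_fin_two] at ha hb
  have h0 : cross a b * y 0 = 0 := by rw [cross]; linear_combination b 1 * ha - a 1 * hb
  have h1 : cross a b * y 1 = 0 := by rw [cross]; linear_combination a 0 * hb - b 0 * ha
  ext i
  fin_cases i
  · simpa [h] using h0
  · simpa [h] using h1

theorem inner_self_quarterTurn_pos {a : EuclideanSpace ℝ (Fin 2)} (ha : a ≠ 0) :
    0 < ⟪quarterTurn a, quarterTurn a⟫ := by
  have : ⟪quarterTurn a, quarterTurn a⟫ = ⟪a, a⟫ := by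
    simp only [inner_fin_two, quarterTurn, Matrix.cons_val_zero,
      Matrix.cons_val_one]
    ring
  rw [this]
  exact real_inner_self_pos.2 ha

theorem cross_quarterTurn_ne_zero {a : EuclideanSpace ℝ (Fin 2)} (ha : a ≠ 0) :
    cross a (quarterTurn a) ≠ 0 := by
  have : cross a (quarterTurn a) = ⟪a, a⟫ := by
    simp only [cross, inner_fin_two, quarterTurn, Matrix.cons_val_zero,
      Matrix.cons_val_one]
    ring
  rw [this]
  exact (real_inner_self_pos.2 ha).ne'

theorem Generic.ne {p : Cfg V 2} (hp : Generic p) {a b : V} (hab : a ≠ b) : p a ≠ p b := by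
  have := hp.eval_ne_zero (MvPolynomial.X (a, 0) - MvPolynomial.X (b, 0))
    (q := fun v => if v = a then !₂[1, 0] else 0) (by simp [coords, hab.symm])
  simp only [map_sub, MvPolynomial.aeval_X, coords] at this
  intro h
  rw [h, sub_self] at this
  exact this rfl

theorem Generic.cross_ne_zero {p : Cfg V 2} (hp : Generic p) {a b c : V} (hab : a ≠ b)
    (hac : a ≠ c) (hbc : b ≠ c) : cross (p a - p b) (p a - p c) ≠ 0 := by
  have := hp.eval_ne_zero
    ((MvPolynomial.X (a, 0) - MvPolynomial.X (b, 0)) *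
        (MvPolynomial.X (a, 1) - MvPolynomial.X (c, 1)) -
      (MvPolynomial.X (a, 1) - MvPolynomial.X (b, 1)) *
        (MvPolynomial.X (a, 0) - MvPolynomial.X (c, 0)))
    (q := fun v => if v = b then !₂[1, 0] else if v = c then !₂[0, 1] else 0)
    (by simp [coords, hab, hac, hbc.symm])
  simpa only [map_sub, map_mul, MvPolynomial.aeval_X, coords, cross, PiLp.sub_apply] using this

/-- The first-order length changes of the edges in `E`, together with three parameters that fix
a rigid motion of the plane. -/
noncomputable def pinnedMap (p : Cfg V 2) (E : Finset (Sym2 V)) (a b : V) :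
    Cfg V 2 →ₗ[ℝ] (E → ℝ) × EuclideanSpace ℝ (Fin 2) × ℝ where
  toFun u := (fun e => edgeForm p u e, u a, ⟪quarterTurn (p b - p a), u b - u a⟫)
  map_add' u w := by
    simp only [edgeForm_add, Pi.add_apply, add_sub_add_comm, inner_add_right]
    rfl
  map_smul' c u := by
    simp only [edgeForm_smul, Pi.smul_apply, ← smul_sub, real_inner_smul_right]
    rfl

theorem Independent.card_add_three_le {p : Cfg V 2} {E : Finset (Sym2 V)} (hE : Independent p E)
    {W : Finset V} (hEW : ∀ e ∈ E, ∀ v ∈ e, v ∈ W) {a b : V} (ha : a ∈ W) (hb : b ∈ W)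
    (hab : p a ≠ p b) : E.card + 3 ≤ 2 * W.card := by
  let R : Cfg V 2 →ₗ[ℝ] ({v // v ∉ W} → EuclideanSpace ℝ (Fin 2)) :=
    LinearMap.funLeft ℝ _ Subtype.val
  have hsurj : Function.Surjective ((pinnedMap p E a b).prod R) := by
    rintro ⟨⟨t, x, s⟩, r⟩
    obtain ⟨u, hu⟩ := hE fun e => if he : e ∈ E then t ⟨e, he⟩ else 0
    let J := quarterTurn (p b - p a)
    have hJ : 0 < ⟪J, J⟫ := inner_self_quarterTurn_pos (sub_ne_zero.2 hab.symm)
    let θ := (s - ⟪J, u b - u a⟫) / ⟪J, J⟫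
    let w : Cfg V 2 := u + fun v => (x - u a) + θ • quarterTurn (p v - p a)
    have hwE : ∀ e, edgeForm p w e = edgeForm p u e := by
      intro e
      rw [edgeForm_add, add_eq_left]
      induction e with | _ i j =>
      simp only [edgeForm_mk, inner_fin_two, quarterTurn, PiLp.sub_apply, PiLp.add_apply,
        PiLp.smul_apply, Matrix.cons_val_zero, Matrix.cons_val_one, smul_eq_mul]
      ring
    have hwa : w a = x := by
      ext i
      fin_cases i <;> simp [w, quarterTurn]
    have hwb : w b = u b + ((x - u a) + θ • J) := rfl
    let w' : Cfg V 2 := fun v => if h : v ∈ W then w v else r ⟨v, h⟩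
    have hw' : ∀ v ∈ W, w' v = w v := fun v hv => dif_pos hv
    refine ⟨w', Prod.ext (Prod.ext (funext fun e => ?_) (Prod.ext ?_ ?_)) (funext fun v => ?_)⟩
    · change edgeForm p w' e = t e
      rw [edgeForm_congr (fun _ _ => rfl) (fun v hv => hw' v (hEW e e.2 v hv)), hwE, hu e e.2,
        dif_pos e.2]
    · change w' a = x
      rw [hw' a ha, hwa]
    · change ⟪J, w' b - w' a⟫ = s
      rw [hw' a ha, hw' b hb, hwa, hwb]
      have : u b + ((x - u a) + θ • J) - x = (u b - u a) + θ • J := by abel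
      rw [this, inner_add_right, real_inner_smul_right, div_mul_cancel₀ _ hJ.ne']
      ring
    · exact dif_neg v.2
  have := LinearMap.finrank_le_finrank_of_surjective hsurj
  simp only [Module.finrank_prod, Module.finrank_pi, Module.finrank_pi_fintype,
    finrank_euclideanSpace_fin, Module.finrank_self, Finset.sum_const, Finset.card_univ,
    Fintype.card_coe, smul_eq_mul, Fintype.card_subtype_compl] at this
  have := W.card_le_univ
  omega

theorem Generic.le_card_add_three {p : Cfg V 2} (hp : Generic p) {E : Finset (Sym2 V)}
    (h : ∀ e, InClosure p E e) {a b : V} (hab : a ≠ b) : 2 * Fintype.card V ≤ E.card + 3 := by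
  have hinj : Function.Injective (pinnedMap p E a b) := by
    rw [← LinearMap.ker_eq_bot, LinearMap.ker_eq_bot']
    intro u hu
    have h1 : ∀ e, edgeForm p u e = 0 := fun e =>
      h e u fun f hf => congrFun (congrArg Prod.fst hu) ⟨f, hf⟩
    have h2 : u a = 0 := congrArg (fun x => x.2.1) hu
    have h3 : ⟪quarterTurn (p b - p a), u b - u a⟫ = 0 := congrArg (fun x => x.2.2) hu
    have h4 : u b = 0 := by
      have h5 := h1 s(b, a)
      rw [edgeForm_mk] at h5
      rw [h2, sub_zero] at h3 h5
      exact eq_zero_of_inner_eq_zero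
        (cross_quarterTurn_ne_zero (sub_ne_zero.2 (hp.ne hab.symm))) h5 h3
    funext v
    by_cases hva : v = a
    · rw [hva, h2]; rfl
    by_cases hvb : v = b
    · rw [hvb, h4]; rfl
    have h5 := h1 s(v, a)
    have h6 := h1 s(v, b)
    rw [edgeForm_mk, h2, sub_zero] at h5
    rw [edgeForm_mk, h4, sub_zero] at h6
    exact eq_zero_of_inner_eq_zero (hp.cross_ne_zero hva hvb hab) h5 h6
  have := LinearMap.finrank_le_finrank_of_injective hinj
  simp only [Module.finrank_prod, Module.finrank_pi, Module.finrank_pi_fintype,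
    finrank_euclideanSpace_fin, Module.finrank_self, Finset.sum_const, Finset.card_univ,
    Fintype.card_coe, smul_eq_mul] at this
  omega

/-- Every set of at least two vertices spans at most `2n - 3` edges of `E`. -/
def LamanSparse (E : Finset (Sym2 V)) : Prop :=
  ∀ W : Finset V, 2 ≤ W.card → (E ∩ W.sym2).card + 3 ≤ 2 * W.card

theorem LamanSparse.mono {E F : Finset (Sym2 V)} (hF : LamanSparse F) (h : E ⊆ F) :
    LamanSparse E := fun W hW =>
  (Nat.add_le_add_right (Finset.card_le_card (Finset.inter_subset_inter_right h)) 3).trans (hF W hW)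

theorem card_inter_sym2_add_le (E : Finset (Sym2 V)) (X Y : Finset V) :
    (E ∩ X.sym2).card + (E ∩ Y.sym2).card ≤
      (E ∩ (X ∪ Y).sym2).card + (E ∩ (X ∩ Y).sym2).card := by
  rw [← Finset.card_union_add_card_inter]
  refine Nat.add_le_add (Finset.card_le_card fun e => ?_) (Finset.card_le_card fun e => ?_) <;>
  · simp only [Finset.mem_union, Finset.mem_inter, Finset.mem_sym2_iff]
    grind

/-- If three pairs of vertices lie in tight sets, then the three vertices lie in one tight set. -/
theorem LamanSparse.exists_tight {E : Finset (Sym2 V)} (hE : LamanSparse E)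
    (hloop : ∀ e ∈ E, ¬ e.IsDiag) {a b c : V} (hac : a ≠ c) {X Y Z : Finset V}
    (haX : a ∈ X) (hbX : b ∈ X) (hbY : b ∈ Y) (hcY : c ∈ Y) (haZ : a ∈ Z) (hcZ : c ∈ Z)
    (hX : 2 * X.card ≤ (E ∩ X.sym2).card + 3) (hY : 2 * Y.card ≤ (E ∩ Y.sym2).card + 3)
    (hZ : 2 * Z.card ≤ (E ∩ Z.sym2).card + 3) :
    ∃ W : Finset V, a ∈ W ∧ b ∈ W ∧ c ∈ W ∧ 2 * W.card ≤ (E ∩ W.sym2).card + 3 := by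
  have hunion : ∀ A B : Finset V, 2 ≤ (A ∩ B).card → 2 * A.card ≤ (E ∩ A.sym2).card + 3 →
      2 * B.card ≤ (E ∩ B.sym2).card + 3 →
      2 * (A ∪ B).card ≤ (E ∩ (A ∪ B).sym2).card + 3 := by
    intro A B hAB hA hB
    have h1 := card_inter_sym2_add_le E A B
    have h2 := Finset.card_union_add_card_inter A B
    have h3 := hE _ hAB
    omega
  by_cases hXY : 2 ≤ (X ∩ Y).card
  · exact ⟨X ∪ Y, by simp [haX], by simp [hbX], by simp [hcY], hunion X Y hXY hX hY⟩
  by_cases hYZ : 2 ≤ (Y ∩ Z).card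
  · exact ⟨Y ∪ Z, by simp [haZ], by simp [hbY], by simp [hcY], hunion Y Z hYZ hY hZ⟩
  by_cases hXZ : 2 ≤ (X ∩ Z).card
  · exact ⟨X ∪ Z, by simp [haX], by simp [hbX], by simp [hcZ], hunion X Z hXZ hX hZ⟩
  have hdisj : ∀ A B : Finset V, ¬ 2 ≤ (A ∩ B).card → Disjoint (E ∩ A.sym2) (E ∩ B.sym2) := by
    intro A B hAB
    rw [Finset.disjoint_left]
    intro e heA heB
    apply hAB
    have hl := hloop e (Finset.mem_inter.1 heA).1
    induction e with | _ i j =>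
    simp only [Finset.mem_inter, Finset.mk_mem_sym2_iff, Sym2.mk_isDiag_iff] at heA heB hl
    rw [← Finset.card_pair hl]
    refine Finset.card_le_card fun v hv => ?_
    simp only [Finset.mem_insert, Finset.mem_singleton] at hv
    rcases hv with rfl | rfl <;> simp [heA, heB]
  refine ⟨X ∪ Y ∪ Z, by simp [haX], by simp [hbX], by simp [hcY], ?_⟩
  have h1 : (E ∩ X.sym2).card + (E ∩ Y.sym2).card + (E ∩ Z.sym2).card ≤
      (E ∩ (X ∪ Y ∪ Z).sym2).card := by
    rw [← Finset.card_union_of_disjoint (hdisj X Y hXY), ← Finset.card_union_of_disjoint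
      (Finset.disjoint_union_left.2 ⟨hdisj X Z hXZ, hdisj Y Z hYZ⟩)]
    refine Finset.card_le_card fun e => ?_
    simp only [Finset.mem_union, Finset.mem_inter, Finset.mem_sym2_iff]
    grind
  have h2 := Finset.card_union_add_card_inter X Y
  have h3 := Finset.card_union_add_card_inter (X ∪ Y) Z
  have h4 : 1 ≤ (X ∩ Y).card := Finset.card_pos.2 ⟨b, Finset.mem_inter.2 ⟨hbX, hbY⟩⟩
  have h5 : 2 ≤ ((X ∪ Y) ∩ Z).card := by
    rw [← Finset.card_pair hac]
    refine Finset.card_le_card fun v hv => ?_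
    simp only [Finset.mem_insert, Finset.mem_singleton] at hv
    rcases hv with rfl | rfl <;> simp [*]
  omega

theorem LamanSparse.insert_or_tight {E : Finset (Sym2 V)} (hE : LamanSparse E) {a b : V}
    (hab : a ≠ b) : (s(a, b) ∉ E ∧ LamanSparse (insert s(a, b) E)) ∨
      ∃ X : Finset V, a ∈ X ∧ b ∈ X ∧ 2 * X.card ≤ (E ∩ X.sym2).card + 3 := by
  by_cases hmem : s(a, b) ∈ E
  · refine Or.inr ⟨{a, b}, by simp, by simp, ?_⟩
    have : 0 < (E ∩ ({a, b} : Finset V).sym2).card :=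
      Finset.card_pos.2 ⟨s(a, b), by simp [hmem]⟩
    rw [Finset.card_pair hab]
    omega
  by_cases h : LamanSparse (insert s(a, b) E)
  · exact Or.inl ⟨hmem, h⟩
  simp only [LamanSparse, not_forall, not_le] at h
  obtain ⟨X, hX, hlt⟩ := h
  by_cases hs : s(a, b) ∈ X.sym2
  · rw [Finset.insert_inter_of_mem hs] at hlt
    have := Finset.card_insert_le s(a, b) (E ∩ X.sym2)
    rw [Finset.mk_mem_sym2_iff] at hs
    exact Or.inr ⟨X, hs.1, hs.2, by omega⟩
  · rw [Finset.insert_inter_of_notMem hs] at hlt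
    have := hE X hX
    omega

theorem LamanSparse.exists_insert {E : Finset (Sym2 V)} (hE : LamanSparse E)
    (hloop : ∀ e ∈ E, ¬ e.IsDiag) {v a b c : V} (hab : a ≠ b) (hac : a ≠ c) (hbc : b ≠ c)
    (ha : s(v, a) ∈ E) (hb : s(v, b) ∈ E) (hc : s(v, c) ∈ E) :
    ∃ x y z, ({x, y, z} : Finset V) = {a, b, c} ∧
      s(x, y) ∉ E.filter (v ∉ ·) ∧ LamanSparse (insert s(x, y) (E.filter (v ∉ ·))) := by
  have hE' : LamanSparse (E.filter (v ∉ ·)) := hE.mono (Finset.filter_subset _ _)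
  rcases hE'.insert_or_tight hab with h | ⟨X, haX, hbX, hX⟩
  · exact ⟨a, b, c, rfl, h⟩
  rcases hE'.insert_or_tight hbc with h | ⟨Y, hbY, hcY, hY⟩
  · exact ⟨b, c, a, by grind, h⟩
  rcases hE'.insert_or_tight hac with h | ⟨Z, haZ, hcZ, hZ⟩
  · exact ⟨a, c, b, by grind, h⟩
  obtain ⟨W, haW, hbW, hcW, hW⟩ := hE'.exists_tight
    (fun e he => hloop e (Finset.mem_filter.1 he).1) hac haX hbX hbY hcY haZ hcZ hX hY hZ
  have h3 : ({s(v, a), s(v, b), s(v, c)} : Finset (Sym2 V)).card = 3 := by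
    rw [Finset.card_eq_three]
    exact ⟨_, _, _, fun h => hab (Sym2.congr_right.1 h), fun h => hac (Sym2.congr_right.1 h),
      fun h => hbc (Sym2.congr_right.1 h), rfl⟩
  have hd : Disjoint (E.filter (v ∉ ·) ∩ W.sym2) {s(v, a), s(v, b), s(v, c)} := by
    rw [Finset.disjoint_left]
    intro e he he'
    have := (Finset.mem_filter.1 (Finset.mem_inter.1 he).1).2
    simp only [Finset.mem_insert, Finset.mem_singleton] at he'
    rcases he' with rfl | rfl | rfl <;> simp at this
  have hle : (E.filter (v ∉ ·) ∩ W.sym2).card + 3 ≤ (E ∩ (insert v W).sym2).card := by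
    rw [← h3, ← Finset.card_union_of_disjoint hd]
    refine Finset.card_le_card fun e he => ?_
    simp only [Finset.mem_union, Finset.mem_inter, Finset.mem_filter, Finset.mem_sym2_iff,
      Finset.mem_insert, Finset.mem_singleton] at he ⊢
    rcases he with ⟨⟨he, _⟩, hW⟩ | rfl | rfl | rfl
    · exact ⟨he, fun x hx => Or.inr (hW x hx)⟩
    all_goals simp [*]
  have hcard : 2 ≤ (insert v W).card := by
    rw [← Finset.card_pair hab]
    refine Finset.card_le_card fun x hx => ?_
    simp only [Finset.mem_insert, Finset.mem_singleton] at hx ⊢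
    rcases hx with rfl | rfl <;> simp [*]
  have := hE _ hcard
  have := Finset.card_insert_le v W
  omega

theorem Independent.extend_vertex {p : Cfg V 2} {E F : Finset (Sym2 V)} (hF : Independent p F)
    {v : V} (hv : ∀ e ∈ F, v ∉ e) {N : Finset V} (hvN : v ∉ N)
    (hE : ∀ e ∈ E, e ∈ F ∨ ∃ x ∈ N, e = s(v, x))
    (hN : ∀ f : V → ℝ, ∃ y, ∀ x ∈ N, ⟪p v - p x, y⟫ = f x) : Independent p E := by
  intro t
  obtain ⟨u, hu⟩ := hF t
  obtain ⟨y, hy⟩ := hN fun x => t s(v, x) + ⟪p v - p x, u x⟫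
  refine ⟨Function.update u v y, fun e he => ?_⟩
  rcases hE e he with he | ⟨x, hx, rfl⟩
  · rw [← hu e he]
    exact edgeForm_congr (fun _ _ => rfl)
      fun w hw => Function.update_of_ne (ne_of_mem_of_not_mem hw (hv e he)) _ _
  · rw [edgeForm_mk, Function.update_self, Function.update_of_ne (ne_of_mem_of_not_mem hx hvN),
      inner_sub_right, hy x hx, add_sub_cancel_right]

theorem Generic.exists_forall_inner_eq {p : Cfg V 2} (hp : Generic p) {v : V} {N : Finset V}
    (hvN : v ∉ N) (hN : N.card ≤ 2) (f : V → ℝ) :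
    ∃ y, ∀ x ∈ N, ⟪p v - p x, y⟫ = f x := by
  obtain h | h | h : N.card = 0 ∨ N.card = 1 ∨ N.card = 2 := by omega
  · rw [Finset.card_eq_zero] at h
    exact ⟨0, by simp [h]⟩
  · obtain ⟨a, rfl⟩ := Finset.card_eq_one.1 h
    simp only [Finset.mem_singleton] at hvN
    obtain ⟨y, hy, -⟩ := exists_inner_eq
      (cross_quarterTurn_ne_zero (sub_ne_zero.2 (hp.ne hvN))) (f a) 0
    exact ⟨y, by simpa using hy⟩
  · obtain ⟨a, b, hab, rfl⟩ := Finset.card_eq_two.1 h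
    simp only [Finset.mem_insert, Finset.mem_singleton, not_or] at hvN
    obtain ⟨y, hy⟩ := exists_inner_eq (hp.cross_ne_zero hvN.1 hvN.2 hab) (f a) (f b)
    exact ⟨y, by simpa using hy⟩

/-- Subdividing an edge of an independent set and joining the new vertex to a further vertex
preserves independence. -/
theorem Generic.independent_edge_split {p : Cfg V 2} (hp : Generic p) {E F : Finset (Sym2 V)}
    {v a b c : V} (hva : v ≠ a) (hvb : v ≠ b) (hvc : v ≠ c) (hab : a ≠ b) (hac : a ≠ c)
    (hbc : b ≠ c) (hv : ∀ e ∈ F, v ∉ e) (habF : s(a, b) ∉ F)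
    (hF : Independent p (insert s(a, b) F))
    (hE : ∀ e ∈ E, e ∈ F ∨ e = s(v, a) ∨ e = s(v, b) ∨ e = s(v, c)) : Independent p E := by
  let m : EuclideanSpace ℝ (Fin 2) := (1 / 2 : ℝ) • (p a + p b)
  refine hp.independent (q := Function.update p v m) fun t => ?_
  obtain ⟨u, hu⟩ := hF (Function.update t s(a, b) (2 * (t s(v, a) + t s(v, b))))
  have huab := hu _ (Finset.mem_insert_self _ _)
  rw [Function.update_self, edgeForm_mk] at huab
  have hcross : cross (m - p b) (m - p c) ≠ 0 := by
    have : cross (p a - p b) (p a - p c) = 2 * cross (m - p b) (m - p c) := by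
      simp only [cross, m, PiLp.sub_apply, PiLp.smul_apply, PiLp.add_apply, smul_eq_mul]
      ring
    have h := hp.cross_ne_zero hab hac hbc
    rw [this] at h
    exact right_ne_zero_of_mul h
  obtain ⟨y, hyb, hyc⟩ := exists_inner_eq hcross
    (t s(v, b) + ⟪m - p b, u b⟫) (t s(v, c) + ⟪m - p c, u c⟫)
  refine ⟨Function.update u v y, fun e he => ?_⟩
  rcases hE e he with he | rfl | rfl | rfl
  · have h := hu e (Finset.mem_insert_of_mem he)
    rw [Function.update_of_ne (ne_of_mem_of_not_mem he habF)] at h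
    rw [← h]
    exact edgeForm_congr
      (fun w hw => Function.update_of_ne (ne_of_mem_of_not_mem hw (hv e he)) _ _)
      (fun w hw => Function.update_of_ne (ne_of_mem_of_not_mem hw (hv e he)) _ _)
  · rw [edgeForm_mk]
    simp only [Function.update_self, Function.update_of_ne hva.symm]
    simp only [inner_fin_two, m, PiLp.sub_apply, PiLp.smul_apply, PiLp.add_apply,
      smul_eq_mul] at hyb huab ⊢
    linear_combination (1 / 2) * huab - hyb
  · rw [edgeForm_mk]
    simp only [Function.update_self, Function.update_of_ne hvb.symm]
    rw [inner_sub_right, hyb, add_sub_cancel_right]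
  · rw [edgeForm_mk]
    simp only [Function.update_self, Function.update_of_ne hvc.symm]
    rw [inner_sub_right, hyc, add_sub_cancel_right]

theorem exists_card_filter_mem_le_three {E : Finset (Sym2 V)} {S : Finset V}
    (hE : E.card + 3 ≤ 2 * S.card) : ∃ v ∈ S, (E.filter (v ∈ ·)).card ≤ 3 := by
  by_contra! h
  have h1 : S.card • 4 ≤ ∑ v ∈ S, (E.filter (v ∈ ·)).card :=
    Finset.card_nsmul_le_sum _ _ _ fun v hv => h v hv
  have h2 : ∑ e ∈ E, (S.filter (· ∈ e)).card ≤ E.card • 2 := by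
    refine Finset.sum_le_card_nsmul _ _ _ fun e _ => ?_
    induction e with | _ i j =>
    refine (Finset.card_le_card (t := {i, j}) fun x hx => ?_).trans Finset.card_le_two
    simpa using (Finset.mem_filter.1 hx).2
  have h3 : ∑ v ∈ S, (E.filter (v ∈ ·)).card = ∑ e ∈ E, (S.filter (· ∈ e)).card :=
    Finset.sum_card_bipartiteAbove_eq_sum_card_bipartiteBelow (fun v e => v ∈ e)
  simp only [smul_eq_mul] at h1 h2
  omega

theorem Generic.independent_of_lamanSparse {p : Cfg V 2} (hp : Generic p) (S : Finset V) :
    ∀ E : Finset (Sym2 V), (∀ e ∈ E, ¬ e.IsDiag) → E ⊆ S.sym2 → LamanSparse E →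
      Independent p E := by
  induction S using Finset.strongInduction with | _ S ih =>
  intro E hloop hES hE
  by_cases hS : 2 ≤ S.card
  swap
  · intro t
    refine ⟨0, fun e he => ?_⟩
    have h1 := hES he
    have h2 := hloop e he
    induction e with | _ i j =>
    rw [Finset.mk_mem_sym2_iff] at h1
    exact absurd (Finset.card_le_one.1 (by omega) i h1.1 j h1.2) h2
  have hcard := hE S hS
  rw [Finset.inter_eq_left.2 hES] at hcard
  obtain ⟨v, hvS, hdeg⟩ := exists_card_filter_mem_le_three hcard
  let N := Finset.univ.filter fun x => s(v, x) ∈ E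
  have hNE : ∀ x ∈ N, s(v, x) ∈ E := fun x hx => (Finset.mem_filter.1 hx).2
  have hvN : v ∉ N := fun h => hloop _ (hNE v h) rfl
  have hN : N.card ≤ 3 := by
    refine (Finset.card_le_card_of_injOn (fun x => s(v, x)) (fun x hx => ?_) ?_).trans hdeg
    · exact Finset.mem_filter.2 ⟨hNE x hx, Sym2.mem_mk_left _ _⟩
    · intro x _ y _ hxy
      exact Sym2.congr_right.1 hxy
  have hsplit : ∀ e ∈ E, e ∈ E.filter (v ∉ ·) ∨ ∃ x ∈ N, e = s(v, x) := by
    intro e he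
    by_cases hv : v ∈ e
    · obtain ⟨x, rfl⟩ := hv
      exact Or.inr ⟨x, Finset.mem_filter.2 ⟨Finset.mem_univ _, he⟩, rfl⟩
    · exact Or.inl (Finset.mem_filter.2 ⟨he, hv⟩)
  have hvF : ∀ e ∈ E.filter (v ∉ ·), v ∉ e := fun e he => (Finset.mem_filter.1 he).2
  have hloop' : ∀ e ∈ E.filter (v ∉ ·), ¬ e.IsDiag := fun e he =>
    hloop e (Finset.mem_filter.1 he).1
  have hsub : E.filter (v ∉ ·) ⊆ (S.erase v).sym2 := by
    intro e he
    rw [Finset.mem_sym2_iff]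
    intro w hw
    exact Finset.mem_erase.2 ⟨ne_of_mem_of_not_mem hw (hvF e he),
      Finset.mem_sym2_iff.1 (hES (Finset.mem_filter.1 he).1) w hw⟩
  by_cases hN2 : N.card ≤ 2
  · exact (ih _ (Finset.erase_ssubset hvS) _ hloop' hsub
      (hE.mono (Finset.filter_subset _ _))).extend_vertex hvF hvN hsplit
      (hp.exists_forall_inner_eq hvN hN2)
  obtain ⟨a, b, c, hab, hac, hbc, hNabc⟩ := Finset.card_eq_three.1 (show N.card = 3 by omega)
  obtain ⟨x, y, z, hxyz, hxy, hsparse⟩ := hE.exists_insert hloop (v := v) hab hac hbc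
    (hNE a (by simp [hNabc])) (hNE b (by simp [hNabc])) (hNE c (by simp [hNabc]))
  rw [← hxyz] at hNabc
  have hcard3 : ({x, y, z} : Finset V).card = 3 := by
    rw [hxyz]; exact Finset.card_eq_three.2 ⟨a, b, c, hab, hac, hbc, rfl⟩
  have hxy' : x ≠ y := by
    rintro rfl
    have := Finset.card_le_two (a := x) (b := z)
    simp at hcard3
    omega
  have hxz' : x ≠ z := by
    rintro rfl
    have := Finset.card_le_two (a := x) (b := y)
    rw [show ({x, y, x} : Finset V) = {x, y} by grind] at hcard3
    omega
  have hyz' : y ≠ z := by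
    rintro rfl
    have := Finset.card_le_two (a := x) (b := y)
    simp at hcard3
    omega
  have hmemN : ∀ w ∈ ({x, y, z} : Finset V), w ∈ S.erase v := by
    intro w hw
    rw [← hNabc] at hw
    exact Finset.mem_erase.2 ⟨ne_of_mem_of_not_mem hw hvN,
      (Finset.mk_mem_sym2_iff.1 (hES (hNE w hw))).2⟩
  have hx := hmemN x (by simp)
  have hy := hmemN y (by simp)
  have hz := hmemN z (by simp)
  refine hp.independent_edge_split (Finset.ne_of_mem_erase hx).symm
    (Finset.ne_of_mem_erase hy).symm (Finset.ne_of_mem_erase hz).symm hxy' hxz' hyz' hvF hxy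
    (ih _ (Finset.erase_ssubset hvS) _ ?_ ?_ hsparse) fun e he => ?_
  · intro e he
    rcases Finset.mem_insert.1 he with rfl | he
    · simpa using hxy'
    · exact hloop' e he
  · exact Finset.insert_subset (Finset.mk_mem_sym2_iff.2 ⟨hx, hy⟩) hsub
  · rcases hsplit e he with h | ⟨w, hw, rfl⟩
    · exact Or.inl h
    · rw [hNabc] at hw
      simp only [Finset.mem_insert, Finset.mem_singleton] at hw
      rcases hw with rfl | rfl | rfl <;> simp

theorem mem_erase_iff_mem_edgeSet_deleteEdges {G : SimpleGraph V} {E : Finset (Sym2 V)}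
    (hE : ∀ e, e ∈ E ↔ e ∈ G.edgeSet) (e f : Sym2 V) :
    f ∈ E.erase e ↔ f ∈ (G.deleteEdges {e}).edgeSet := by
  rw [SimpleGraph.edgeSet_deleteEdges, Finset.mem_erase, hE, Set.mem_sdiff, Set.mem_singleton_iff,
    and_comm]

/-- A generic framework is minimally rigid if and only if its edges form a basis of the rigidity
matroid. -/
theorem Generic.minimally_rigid_iff {p : Cfg V d} (hp : Generic p) {G : SimpleGraph V}
    {E : Finset (Sym2 V)} (hE : ∀ e, e ∈ E ↔ e ∈ G.edgeSet) :
    (Rigid G p ∧ ∀ e ∈ G.edgeSet, ¬ Rigid (G.deleteEdges {e}) p) ↔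
      Independent p E ∧ ∀ e, InClosure p E e := by
  rw [hp.rigid_iff hE, and_comm]
  refine and_congr_left fun hcl => ?_
  constructor
  · intro hdel
    obtain ⟨F, hFE, hF, hEF⟩ := exists_independent_subset_closure p E
    refine hF.mono fun e he => by_contra fun heF => hdel e ((hE e).1 he) ?_
    rw [hp.rigid_iff (mem_erase_iff_mem_edgeSet_deleteEdges hE e)]
    exact fun f => ((hcl f).trans hEF).trans fun g hg =>
      inClosure_of_mem (Finset.mem_erase.2 ⟨ne_of_mem_of_not_mem hg heF, hFE hg⟩)
  · intro hind e he
    rw [hp.rigid_iff (mem_erase_iff_mem_edgeSet_deleteEdges hE e)]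
    rw [← Finset.insert_erase ((hE e).2 he)] at hind
    exact fun h => not_inClosure_of_independent_insert (Finset.notMem_erase _ _) hind (h e)

theorem Generic.independent_iff {p : Cfg V 2} (hp : Generic p) {E : Finset (Sym2 V)}
    (hloop : ∀ e ∈ E, ¬ e.IsDiag) : Independent p E ↔ LamanSparse E := by
  refine ⟨fun h W hW => ?_, hp.independent_of_lamanSparse Finset.univ E hloop (by simp)⟩
  obtain ⟨a, ha, b, hb, hab⟩ := Finset.one_lt_card.1 hW
  exact (h.mono Finset.inter_subset_left).card_add_three_le
    (fun e he => Finset.mem_sym2_iff.1 (Finset.mem_inter.1 he).2) ha hb (hp.ne hab)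

theorem Generic.inClosure_of_two_mul_card_le {p : Cfg V 2} (hp : Generic p) {E : Finset (Sym2 V)}
    (hE : Independent p E) {a b : V} (hab : a ≠ b) (h : 2 * Fintype.card V ≤ E.card + 3)
    (e : Sym2 V) : InClosure p E e := by
  by_contra he
  have h1 := (independent_insert hE he).card_add_three_le (W := Finset.univ) (by simp)
    (Finset.mem_univ a) (Finset.mem_univ b) (hp.ne hab)
  rw [Finset.card_insert_of_notMem fun h => he (inClosure_of_mem h), Finset.card_univ] at h1
  omega

theorem lamanSparse_iff {G : SimpleGraph V} {E : Finset (Sym2 V)}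
    (hE : ∀ e, e ∈ E ↔ e ∈ G.edgeSet) :
    LamanSparse E ↔ ∀ W : Set V, 2 ≤ W.ncard →
      {e ∈ G.edgeSet | ∀ v ∈ e, v ∈ W}.ncard ≤ 2 * W.ncard - 3 := by
  have key : ∀ W : Finset V,
      {e ∈ G.edgeSet | ∀ v ∈ e, v ∈ (W : Set V)} = ((E ∩ W.sym2 : Finset (Sym2 V)) : Set _) := by
    intro W
    ext e
    simp only [Set.mem_ofPred_eq, Finset.mem_coe, Finset.mem_inter, Finset.mem_sym2_iff, hE]
  constructor
  · intro h W hW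
    lift W to Finset V using W.toFinite
    rw [Set.ncard_coe_finset] at hW ⊢
    rw [key, Set.ncard_coe_finset]
    have := h W hW
    omega
  · intro h W hW
    have := h W (by rwa [Set.ncard_coe_finset])
    rw [key, Set.ncard_coe_finset, Set.ncard_coe_finset] at this
    omega

/-- **Laman's Theorem.** A generic framework `(G,p)` in the plane is rigid and ceases
to be rigid after removing any single edge if and only if `G` has exactly `2n - 3`
edges and every set of `n' ≥ 2` vertices induces at most `2n' - 3` edges. -/
theorem laman {V : Type*} [Fintype V] [DecidableEq V] (G : SimpleGraph V)
    (p : Cfg V 2) (hp : Generic p) :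
    (Rigid G p ∧ ∀ e ∈ G.edgeSet, ¬ Rigid (G.deleteEdges {e}) p) ↔
      (G.edgeSet.ncard = 2 * Fintype.card V - 3 ∧
        ∀ W : Set V, 2 ≤ W.ncard →
          {e ∈ G.edgeSet | ∀ v ∈ e, v ∈ W}.ncard ≤ 2 * W.ncard - 3) := by
  obtain ⟨E, hEG⟩ := G.edgeSet.toFinite.exists_finset
  have hloop : ∀ e ∈ E, ¬ e.IsDiag := fun e he => G.not_isDiag_of_mem_edgeSet ((hEG e).1 he)
  have hcard : G.edgeSet.ncard = E.card := by
    rw [← Set.ncard_coe_finset]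
    congr 1
    ext e
    simp [hEG]
  rw [hp.minimally_rigid_iff hEG, ← lamanSparse_iff hEG, hp.independent_iff hloop, and_comm, hcard]
  refine and_congr_left fun hsparse => ?_
  rcases subsingleton_or_nontrivial V with hV | hV
  · have hE : E = ∅ := by
      refine Finset.eq_empty_of_forall_notMem fun e he => hloop e he ?_
      induction e with | _ i j =>
      exact Subsingleton.elim i j
    have hV' := Fintype.card_le_one_iff_subsingleton.2 hV
    refine iff_of_true (fun e u _ => ?_) (by rw [hE, Finset.card_empty]; omega)
    induction e with | _ i j =>
    rw [edgeForm_mk, Subsingleton.elim i j, sub_self, inner_zero_left]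
  · obtain ⟨a, b, hab⟩ := exists_pair_ne V
    have hle := hsparse Finset.univ
      (by rw [Finset.card_univ]; exact Fintype.one_lt_card)
    rw [Finset.inter_eq_left.2 (by simp), Finset.card_univ] at hle
    constructor
    · intro h
      have := hp.le_card_add_three h hab
      omega
    · intro h
      exact hp.inClosure_of_two_mul_card_le ((hp.independent_iff hloop).2 hsparse) hab (by omega)

end CoordRigidity
end

section
/- If a framework (G,p) is infinitesimally rigid, then it is rigid. Conversely, if (G,p) is generic and infinitesimally flexible, then it is flexible. (Asimow–Roth) -/
open scoped RealInnerProductSpace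

namespace CoordRigidity

variable {V : Type*} [Fintype V] [DecidableEq V] {d k : ℕ}

section AsimowRoth

/-- If every linear relation among the `a i` also holds among the `b i`, some linear map sends
each `a i` to `b i`. -/
theorem exists_linearMap_of_relations {K ι M N : Type*} [Field K] [Fintype ι]
    [AddCommGroup M] [Module K M] [AddCommGroup N] [Module K N] (a : ι → M) (b : ι → N)
    (h : ∀ c : ι → K, ∑ i, c i • a i = 0 → ∑ i, c i • b i = 0) :
    ∃ S : M →ₗ[K] N, ∀ i, S (a i) = b i := by
  classical
  let La := Fintype.linearCombination K a
  let Lb := Fintype.linearCombination K b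
  obtain ⟨g, hg⟩ := La.rangeRestrict.exists_rightInverse_of_surjective La.range_rangeRestrict
  obtain ⟨S, hS⟩ := (Lb ∘ₗ g).exists_extend
  refine ⟨S, fun i => ?_⟩
  have ha : La (Pi.single i 1) = a i := by simp [La]
  have hb : Lb (Pi.single i 1) = b i := by simp [Lb]
  let w : La.range := ⟨a i, Pi.single i 1, ha⟩
  have hgw : La (g w) = a i := congrArg Subtype.val (LinearMap.congr_fun hg w)
  have hker : Lb (g w - Pi.single i 1) = 0 := by
    apply h
    change La (g w - Pi.single i 1) = 0
    rw [map_sub, hgw, ha, sub_self]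
  rw [map_sub, hb, sub_eq_zero] at hker
  rw [← hker]
  exact LinearMap.congr_fun hS w

section Congruence

variable {E : Type*} [NormedAddCommGroup E] [InnerProductSpace ℝ E]

theorem inner_sub_sub_eq_of_dist_eq {V : Type*} {p q : V → E}
    (h : ∀ i j, dist (p i) (p j) = dist (q i) (q j)) (o i j : V) :
    ⟪p i - p o, p j - p o⟫ = ⟪q i - q o, q j - q o⟫ := by
  simp only [dist_eq_norm] at h
  rw [real_inner_eq_norm_mul_self_add_norm_mul_self_sub_norm_sub_mul_self_div_two,
    real_inner_eq_norm_mul_self_add_norm_mul_self_sub_norm_sub_mul_self_div_two,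
    sub_sub_sub_cancel_right, sub_sub_sub_cancel_right, h, h, h]

theorem norm_sum_smul_eq_of_inner_eq {V : Type*} [Fintype V] {a b : V → E}
    (h : ∀ i j, ⟪a i, a j⟫ = ⟪b i, b j⟫) (c : V → ℝ) :
    ‖∑ i, c i • a i‖ = ‖∑ i, c i • b i‖ := by
  rw [← sq_eq_sq₀ (norm_nonneg _) (norm_nonneg _), ← real_inner_self_eq_norm_sq,
    ← real_inner_self_eq_norm_sq]
  simp only [sum_inner, inner_sum, real_inner_smul_left, real_inner_smul_right, h]

/-- Two families of vectors with the same Gram matrix differ by a linear isometry. -/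
theorem exists_linearIsometryEquiv_of_inner_eq [FiniteDimensional ℝ E] {V : Type*} [Fintype V]
    {a b : V → E} (h : ∀ i j, ⟪a i, a j⟫ = ⟪b i, b j⟫) :
    ∃ T : E ≃ₗᵢ[ℝ] E, ∀ i, T (a i) = b i := by
  have hn := norm_sum_smul_eq_of_inner_eq h
  obtain ⟨S, hS⟩ := exists_linearMap_of_relations a b fun c hc => by
    rw [← norm_eq_zero, ← hn c, hc, norm_zero]
  let W := Submodule.span ℝ (Set.range a)
  let L : W →ₗᵢ[ℝ] E := ⟨S.domRestrict W, fun ⟨w, hw⟩ => by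
    obtain ⟨c, rfl⟩ := (Submodule.mem_span_range_iff_exists_fun ℝ).1 hw
    simp [hS, ← hn c]⟩
  refine ⟨L.extend.toLinearIsometryEquiv rfl, fun i => ?_⟩
  have := L.extend_apply ⟨a i, Submodule.subset_span ⟨i, rfl⟩⟩
  simpa [L, hS] using this

end Congruence

variable {ι : Type*}

theorem isTrivialMotion_iff_exists_toEuclideanCLM {p p' : Cfg ι d} :
    IsTrivialMotion p p' ↔ ∃ (S : Matrix (Fin d) (Fin d) ℝ) (t : EuclideanSpace ℝ (Fin d)),
      S.transpose = -S ∧ ∀ v, p' v = Matrix.toEuclideanCLM (𝕜 := ℝ) S (p v) + t := by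
  constructor
  · rintro ⟨S, t, hS, h⟩
    refine ⟨S, WithLp.toLp 2 t, hS, fun v => ?_⟩
    ext i
    simp [h, Matrix.ofLp_toEuclideanCLM, Matrix.mulVec, dotProduct]
  · rintro ⟨S, t, hS, h⟩
    refine ⟨S, t, hS, fun v i => ?_⟩
    simp [h, Matrix.ofLp_toEuclideanCLM, Matrix.mulVec, dotProduct]

variable [Fintype ι]

theorem congruent_iff_forall_dist_eq {p q : Cfg ι d} :
    Congruent p q ↔ ∀ i j, dist (p i) (p j) = dist (q i) (q j) := by
  refine ⟨fun ⟨T, hT⟩ i j => by rw [hT, hT, T.dist_eq], fun h => ?_⟩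
  rcases isEmpty_or_nonempty ι with _ | ⟨⟨o⟩⟩
  · exact ⟨IsometryEquiv.refl _, fun v => isEmptyElim v⟩
  obtain ⟨T, hT⟩ := exists_linearIsometryEquiv_of_inner_eq
    (fun i j => inner_sub_sub_eq_of_dist_eq h o i j)
  refine ⟨((IsometryEquiv.subRight (p o)).trans T.toIsometryEquiv).trans
    (IsometryEquiv.addRight (q o)), fun v => ?_⟩
  simp [hT v]

/-- The squared Euclidean distance between two configurations. -/
noncomputable def sqDist (p q : Cfg ι d) : ℝ := ∑ v, ‖q v - p v‖ ^ 2

theorem continuous_sqDist (p : Cfg ι d) : Continuous (sqDist p) := by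
  unfold sqDist; fun_prop

theorem dist_sq_le_sqDist (p q : Cfg ι d) : dist q p ^ 2 ≤ sqDist p q := by
  have hs : 0 ≤ sqDist p q := Finset.sum_nonneg fun _ _ => by positivity
  rw [← Real.le_sqrt dist_nonneg hs, dist_pi_le_iff (Real.sqrt_nonneg _)]
  intro v
  rw [Real.le_sqrt dist_nonneg hs, dist_eq_norm]
  exact Finset.single_le_sum (f := fun v => ‖q v - p v‖ ^ 2) (fun _ _ => by positivity)
    (Finset.mem_univ v)

/-- Among the configurations congruent to `q`, one is closest to `p`. -/
theorem exists_congruent_isMinOn_sqDist (p q : Cfg ι d) :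
    ∃ r, Congruent q r ∧ ∀ r', Congruent q r' → sqDist p r ≤ sqDist p r' := by
  have hclosed : IsClosed {r : Cfg ι d | Congruent q r} := by
    simp only [congruent_iff_forall_dist_eq, Set.ofPred_forall]
    exact isClosed_iInter fun i => isClosed_iInter fun j =>
      isClosed_eq (by fun_prop) (by fun_prop)
  have hq : Congruent q q := congruent_iff_forall_dist_eq.2 fun _ _ => rfl
  obtain ⟨r, hr, hmin⟩ := (continuous_sqDist p).continuousOn.exists_isMinOn' hclosed hq (by
    refine Filter.Eventually.filter_mono inf_le_left ?_
    have : Filter.Tendsto (fun r => dist r p ^ 2) (Filter.cocompact (Cfg ι d)) Filter.atTop :=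
      (Filter.tendsto_pow_atTop two_ne_zero).comp (tendsto_dist_right_cocompact_atTop p)
    filter_upwards [this.eventually_ge_atTop (sqDist p q)] with r hr
    exact hr.trans (dist_sq_le_sqDist p r))
  exact ⟨r, hr, fun r' hr' => hmin hr'⟩

/-- Moving a configuration along a one-parameter group of isometries. -/
theorem exists_congruent_curve (r : Cfg ι d) (S : Matrix (Fin d) (Fin d) ℝ)
    (hS : S.transpose = -S) (t : EuclideanSpace ℝ (Fin d)) :
    ∃ γ : ℝ → Cfg ι d, γ 0 = r ∧ (∀ τ, Congruent r (γ τ)) ∧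
      ∀ v, HasDerivAt (fun τ => γ τ v) (Matrix.toEuclideanCLM (𝕜 := ℝ) S (r v) + t) 0 := by
  let A := Matrix.toEuclideanCLM (𝕜 := ℝ) S
  have hA : A ∈ skewAdjoint (EuclideanSpace ℝ (Fin d) →L[ℝ] EuclideanSpace ℝ (Fin d)) := by
    rw [skewAdjoint.mem_iff, ← map_star, Matrix.star_eq_conjTranspose,
      Matrix.conjTranspose_eq_transpose_of_trivial, hS, map_neg]
  have h0 : NormedSpace.exp ((0 : ℝ) • A) = 1 :=
    (congrArg NormedSpace.exp (zero_smul ℝ A)).trans NormedSpace.exp_zero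
  refine ⟨fun τ v => NormedSpace.exp (τ • A) (r v) + τ • t, by simp [h0], fun τ => ?_, fun v => ?_⟩
  · rw [congruent_iff_forall_dist_eq]
    intro i j
    let := NormedAlgebra.restrictScalars ℚ ℝ
      (EuclideanSpace ℝ (Fin d) →L[ℝ] EuclideanSpace ℝ (Fin d))
    have hu : NormedSpace.exp (τ • A) ∈ unitary _ :=
      NormedSpace.exp_mem_unitary_of_mem_skewAdjoint (skewAdjoint.smul_mem τ hA)
    rw [dist_add_right, dist_eq_norm, dist_eq_norm, ← map_sub,
      ContinuousLinearMap.norm_map_of_mem_unitary hu]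
  · have h := (hasDerivAt_exp_smul_const (𝕂 := ℝ) A 0).clm_apply (hasDerivAt_const 0 (r v))
    have h' := h.add ((hasDerivAt_id (0 : ℝ)).smul_const t)
    rw [h0] at h'
    simpa [A] using! h'

theorem sum_inner_eq_zero_of_isMinOn {p r : Cfg ι d}
    (hmin : ∀ r', Congruent r r' → sqDist p r ≤ sqDist p r')
    {S : Matrix (Fin d) (Fin d) ℝ} (hS : S.transpose = -S) (t : EuclideanSpace ℝ (Fin d)) :
    ∑ v, ⟪r v - p v, Matrix.toEuclideanCLM (𝕜 := ℝ) S (r v) + t⟫ = 0 := by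
  obtain ⟨γ, h0, hc, hd⟩ := exists_congruent_curve r S hS t
  have hD : HasDerivAt (fun τ => sqDist p (γ τ))
      (∑ v, 2 * ⟪r v - p v, Matrix.toEuclideanCLM (𝕜 := ℝ) S (r v) + t⟫) 0 := by
    refine HasDerivAt.fun_sum fun v _ => ?_
    simpa [h0] using ((hd v).sub_const (p v)).norm_sq
  have hm : IsLocalMin (fun τ => sqDist p (γ τ)) 0 :=
    Filter.Eventually.of_forall fun τ => by simpa [h0] using hmin _ (hc τ)
  have := hm.hasDerivAt_eq_zero hD
  rw [← Finset.mul_sum] at this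
  linarith

theorem inner_sub_sub_eq_zero_of_dist_eq {E : Type*} [NormedAddCommGroup E]
    [InnerProductSpace ℝ E] {a b a' b' : E} (h : dist a b = dist a' b') :
    ⟪(b' + b) - (a' + a), (b' - b) - (a' - a)⟫ = 0 := by
  have h' : ‖b' - a'‖ = ‖b - a‖ := by rw [← dist_eq_norm', ← dist_eq_norm', h]
  rw [add_sub_add_comm, sub_sub_sub_comm, real_inner_add_sub_eq_zero_iff, h']

theorem InfRigid.rigid {G : SimpleGraph ι} {p : Cfg ι d} (h : InfRigid G p) : Rigid G p := by
  by_contra hR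
  have hfreq : ∃ᶠ q in nhds p, FrameworkEquiv G p q ∧ ¬ Congruent p q := fun hev =>
    hR ⟨_, hev, fun q hq he => by_contra fun hc => hq ⟨he, hc⟩⟩
  obtain ⟨q, hq, hqp⟩ := Filter.exists_seq_forall_of_frequently hfreq
  choose r hr hmin using fun n => exists_congruent_isMinOn_sqDist p (q n)
  simp only [congruent_iff_forall_dist_eq] at hr hqp
  have hrp : Filter.Tendsto r Filter.atTop (nhds p) := by
    rw [tendsto_iff_dist_tendsto_zero]
    have hsq : Filter.Tendsto (fun n => √(sqDist p (q n))) Filter.atTop (nhds 0) := by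
      simpa [sqDist] using! ((continuous_sqDist p).sqrt.tendsto p).comp hq
    refine squeeze_zero (fun _ => dist_nonneg) (fun n => ?_) hsq
    exact Real.le_sqrt_of_sq_le ((dist_sq_le_sqDist p (r n)).trans
      (hmin n _ (congruent_iff_forall_dist_eq.2 fun _ _ => rfl)))
  have hne : ∀ n, r n - p ≠ 0 := fun n hn => (hqp n).2 fun i j => by
    rw [hr n i j, sub_eq_zero.1 hn]
  let u : ℕ → Cfg ι d := fun n => ‖r n - p‖⁻¹ • (r n - p)
  have hu : ∀ n, u n ∈ Metric.sphere (0 : Cfg ι d) 1 := fun n => by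
    simp [u, norm_smul, inv_mul_cancel₀ (norm_ne_zero_iff.2 (hne n))]
  obtain ⟨w, hw, φ, hφ, huw⟩ := (isCompact_sphere (0 : Cfg ι d) 1).tendsto_subseq hu
  have hrφ := hrp.comp hφ.tendsto_atTop
  rw [tendsto_pi_nhds] at huw hrφ
  have hmotion : IsInfMotion G p w := by
    intro i j hij
    have hn : ∀ n, ⟪(r n j + p j) - (r n i + p i), u n j - u n i⟫ = 0 := fun n => by
      have h0 := inner_sub_sub_eq_zero_of_dist_eq (((hqp n).1 i j hij).trans (hr n i j))
      simp only [u, Pi.smul_apply, Pi.sub_apply, ← smul_sub, real_inner_smul_right, h0, mul_zero]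
    have hlim := (((hrφ j).add_const (p j)).sub ((hrφ i).add_const (p i))).inner
      (𝕜 := ℝ) ((huw j).sub (huw i))
    simp only [Function.comp_apply, hn] at hlim
    have h0 := tendsto_nhds_unique hlim tendsto_const_nhds
    rw [add_sub_add_comm, inner_add_left] at h0
    linarith
  obtain ⟨S, t, hS, hwS⟩ := isTrivialMotion_iff_exists_toEuclideanCLM.1 (h w hmotion)
  have horth : ∀ n, ∑ v, ⟪u n v, Matrix.toEuclideanCLM (𝕜 := ℝ) S (r n v) + t⟫ = 0 := fun n => by
    have h0 := sum_inner_eq_zero_of_isMinOn (p := p) (r := r n) (fun r' hr' => hmin n r' <| by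
      rw [congruent_iff_forall_dist_eq] at hr' ⊢
      exact fun i j => (hr n i j).trans (hr' i j)) hS t
    simp only [u, Pi.smul_apply, Pi.sub_apply, real_inner_smul_left, ← Finset.mul_sum, h0,
      mul_zero]
  have hlim : Filter.Tendsto
      (fun n => ∑ v, ⟪u (φ n) v, Matrix.toEuclideanCLM (𝕜 := ℝ) S (r (φ n) v) + t⟫) Filter.atTop
      (nhds (∑ v, ⟪w v, Matrix.toEuclideanCLM (𝕜 := ℝ) S (p v) + t⟫)) :=
    tendsto_finsetSum _ fun v _ => (huw v).inner
      ((((Matrix.toEuclideanCLM (𝕜 := ℝ) S).continuous.tendsto _).comp (hrφ v)).add_const t)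
  simp only [horth, ← hwS, real_inner_self_eq_norm_sq] at hlim
  have h0 := tendsto_nhds_unique hlim tendsto_const_nhds
  rw [Finset.sum_eq_zero_iff_of_nonneg (fun _ _ => by positivity)] at h0
  have hw0 : w = 0 := funext fun v => by simpa using h0 v (Finset.mem_univ v)
  simp [hw0] at hw

section ConstantRank

theorem surjective_pi_of_linearIndependent {X κ : Type*} [AddCommGroup X] [Module ℝ X]
    [Fintype κ] {L : κ → X →ₗ[ℝ] ℝ} (hL : LinearIndependent ℝ L) :
    Function.Surjective (LinearMap.pi L) := by
  classical
  rw [← LinearMap.range_eq_top]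
  by_contra hne
  obtain ⟨f, hf, hle⟩ := Submodule.exists_le_ker_of_lt_top _ (lt_top_iff_ne_top.2 hne)
  refine hf (LinearMap.pi_ext' fun k => LinearMap.ext_ring ?_)
  refine Fintype.linearIndependent_iff.1 hL (fun k => f (Pi.single k 1)) (LinearMap.ext fun x => ?_) k
  have hx : f (LinearMap.pi L x) = 0 := hle ⟨x, rfl⟩
  have he : ∀ k : κ, (Pi.single k 1 : κ → ℝ) = fun j => if k = j then 1 else 0 := fun k => by
    ext j; simp [Pi.single_apply, eq_comm]
  rw [LinearMap.pi_apply_eq_sum_univ] at hx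
  refine Eq.trans ?_ hx
  rw [LinearMap.sum_apply]
  exact Finset.sum_congr rfl fun k _ => by simp [he, mul_comm]

variable {X : Type*} [NormedAddCommGroup X] [NormedSpace ℝ X] [FiniteDimensional ℝ X]

/-- A vector in the kernel of a submersion is tangent to a `C¹` curve in the fibre. -/
theorem exists_curve_in_fibre {κ : Type*} [Fintype κ] {g : κ → X → ℝ}
    (hg : ∀ k, ContDiff ℝ 1 (g k)) {p : X}
    (hind : LinearIndependent ℝ (fun k => fderiv ℝ (g k) p)) {u : X}
    (hu : ∀ k, fderiv ℝ (g k) p u = 0) :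
    ∃ γ : ℝ → X, γ 0 = p ∧ HasDerivAt γ u 0 ∧
      ∀ᶠ t in nhds (0 : ℝ), DifferentiableAt ℝ γ t ∧ ∀ k, g k (γ t) = g k p := by
  have hp := ContDiff.contDiffAt (x := p) (contDiff_pi.2 hg)
  let G : X →L[ℝ] κ → ℝ := ContinuousLinearMap.pi fun k => fderiv ℝ (g k) p
  have hG : HasFDerivAt (fun q k => g k q) G p :=
    hasFDerivAt_pi.2 fun k => ((hg k).differentiable one_ne_zero p).hasFDerivAt
  have hsurj : Function.Surjective (G : X →ₗ[ℝ] κ → ℝ) :=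
    surjective_pi_of_linearIndependent (L := fun k => (fderiv ℝ (g k) p : X →ₗ[ℝ] ℝ))
      (hind.map' (ContinuousLinearMap.coeLM ℝ) (LinearMap.ker_eq_bot.2
        ContinuousLinearMap.coe_injective))
  obtain ⟨B', hB'⟩ := (G : X →ₗ[ℝ] κ → ℝ).exists_rightInverse_of_surjective
    (LinearMap.range_eq_top.2 hsurj)
  let B : (κ → ℝ) →L[ℝ] X := LinearMap.toContinuousLinearMap B'
  have hB : ∀ y, G (B y) = y := fun y => LinearMap.congr_fun hB' y
  let Φ : X → X := fun q => q + B (((fun k => g k q) - fun k => g k p) - G (q - p))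
  have hΦ : ContDiffAt ℝ 1 Φ p := by fun_prop
  have hΦp : Φ p = p := by simp [Φ]
  have hΦ' : HasFDerivAt Φ ((ContinuousLinearEquiv.refl ℝ X : X ≃L[ℝ] X) : X →L[ℝ] X) p := by
    have h : HasFDerivAt Φ _ p := (hasFDerivAt_id p).add (B.hasFDerivAt.comp p
      ((hG.sub_const (fun k => g k p)).sub (G.hasFDerivAt.comp p ((hasFDerivAt_id p).sub_const p))))
    refine h.congr_fderiv ?_
    ext x; simp
  let Ψ := hΦ.localInverse hΦ' one_ne_zero
  have hstrict := hΦ.hasStrictFDerivAt' hΦ' one_ne_zero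
  have hΨ : ContDiffAt ℝ 1 Ψ p := by simpa [hΦp] using hΦ.to_localInverse hΦ' one_ne_zero
  have hΨp : Ψ p = p := by simpa [hΦp] using hΦ.localInverse_apply_image hΦ' one_ne_zero
  have hΨ' : HasFDerivAt Ψ (ContinuousLinearMap.id ℝ X) p := by
    simpa [hΦp] using! hstrict.to_localInverse.hasFDerivAt
  have hright : ∀ᶠ y in nhds p, Φ (Ψ y) = y := by
    simpa [hΦp] using! hstrict.eventually_right_inverse
  let ℓ : ℝ → X := fun t => p + t • u
  have hℓ : Filter.Tendsto ℓ (nhds 0) (nhds p) :=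
    Continuous.tendsto' (by fun_prop) _ _ (by simp [ℓ])
  have hℓd : ∀ t, HasDerivAt ℓ u t := fun t => by
    have h := ((hasDerivAt_id t).smul_const u).const_add p
    rw [one_smul] at h
    exact h
  refine ⟨Ψ ∘ ℓ, by simp [ℓ, hΨp], ?_, ?_⟩
  · have h0 : ℓ 0 = p := by simp [ℓ]
    simpa using (h0 ▸ hΨ').comp_hasDerivAt (0 : ℝ) (hℓd 0)
  · filter_upwards [hℓ.eventually hright, hℓ.eventually (hΨ.eventually (by simp))] with t ht hdt
    refine ⟨(hdt.differentiableAt one_ne_zero).comp t (hℓd t).differentiableAt, fun k => ?_⟩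
    have hGu : G u = 0 := funext hu
    have := congrArg G ht
    simp only [Φ, map_add, hB, ℓ, map_sub, map_smul, hGu, smul_zero, add_zero] at this
    have hk := congrFun this k
    simp only [Pi.add_apply, Pi.sub_apply] at hk
    change g k (Ψ (p + t • u)) = g k p
    linarith

/-- A curve on which `g` is constant also keeps `f` constant if the derivatives of `f` are
combinations of those of `g`. -/
theorem exists_curve_of_fderiv_mem_span {ι κ : Type*} [Fintype κ] {f : ι → X → ℝ}
    (hf : ∀ i, ContDiff ℝ 1 (f i)) {p : X} (a : κ → ι)
    (hind : LinearIndependent ℝ (fun k => fderiv ℝ (f (a k)) p))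
    (hspan : ∀ᶠ q in nhds p, ∀ i, fderiv ℝ (f i) q ∈
      Submodule.span ℝ (Set.range fun k => fderiv ℝ (f (a k)) q)) {u : X}
    (hu : ∀ i, fderiv ℝ (f i) p u = 0) :
    ∃ γ : ℝ → X, γ 0 = p ∧ HasDerivAt γ u 0 ∧ ∃ ε > 0, ContinuousOn γ (Set.Ioo (-ε) ε) ∧
      ∀ t ∈ Set.Ioo (-ε) ε, ∀ i, f i (γ t) = f i p := by
  obtain ⟨γ, h0, hγ, hev⟩ := exists_curve_in_fibre (fun k => hf (a k)) hind fun k => hu (a k)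
  have hcont : Filter.Tendsto γ (nhds 0) (nhds p) := h0 ▸ hγ.continuousAt.tendsto
  obtain ⟨ε, hε, hball⟩ := Metric.eventually_nhds_iff_ball.1 (hev.and (hcont.eventually hspan))
  rw [Real.ball_eq_Ioo, zero_sub, zero_add] at hball
  have hd : ∀ t ∈ Set.Ioo (-ε) ε, ∀ i, HasDerivAt (fun t => f i (γ t))
      (fderiv ℝ (f i) (γ t) (deriv γ t)) t := fun t ht i =>
    ((hf i).differentiable one_ne_zero (γ t)).hasFDerivAt.comp_hasDerivAt t
      (hball t ht).1.1.hasDerivAt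
  have hzero : ∀ t ∈ Set.Ioo (-ε) ε, ∀ i, fderiv ℝ (f i) (γ t) (deriv γ t) = 0 := by
    intro t ht i
    have hk : ∀ k, fderiv ℝ (f (a k)) (γ t) (deriv γ t) = 0 := fun k => by
      refine (hd t ht (a k)).unique ((hasDerivAt_const t (f (a k) p)).congr_of_eventuallyEq ?_)
      filter_upwards [isOpen_Ioo.mem_nhds ht] with s hs using (hball s hs).1.2 k
    obtain ⟨c, hc⟩ := (Submodule.mem_span_range_iff_exists_fun ℝ).1 ((hball t ht).2 i)
    simp [← hc, hk]
  refine ⟨γ, h0, hγ, ε, hε,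
    fun t ht => (hball t ht).1.1.continuousAt.continuousWithinAt, fun t ht i => ?_⟩
  rw [← h0]
  exact isOpen_Ioo.is_const_of_deriv_eq_zero isPreconnected_Ioo
    (fun s hs => (hd s hs i).differentiableAt.differentiableWithinAt)
    (fun s hs => (hd s hs i).deriv.trans (hzero s hs i)) ht ⟨neg_lt_zero.2 hε, hε⟩

end ConstantRank

section Generic

theorem linearIndependent_row_iff_det_mul_transpose_ne_zero {m n : Type*} [Fintype m]
    [DecidableEq m] [Fintype n] (M : Matrix m n ℝ) :
    LinearIndependent ℝ M.row ↔ (M * M.transpose).det ≠ 0 := by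
  rw [Fintype.linearIndependent_iff, ne_eq, ← Matrix.exists_vecMul_eq_zero_iff]
  have h := Matrix.vecMul_self_mul_conjTranspose_eq_zero M
  rw [Matrix.conjTranspose_eq_transpose_of_trivial] at h
  simp only [h, not_exists, not_and', not_not, ne_eq]
  simp only [Matrix.vecMul_eq_sum, funext_iff]
  rfl

/-- Polynomial vectors which are linearly independent somewhere are linearly independent at every
algebraically independent point. -/
theorem linearIndependent_aeval_of_algebraicIndependent {σ m n : Type*} [Fintype m]
    [Fintype n] (A : Matrix m n (MvPolynomial σ ℚ)) {x y : σ → ℝ}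
    (hx : AlgebraicIndependent ℚ x)
    (hy : LinearIndependent ℝ (A.map (MvPolynomial.aeval y)).row) :
    LinearIndependent ℝ (A.map (MvPolynomial.aeval x)).row := by
  classical
  have hdet : ∀ z : σ → ℝ, ((A.map (MvPolynomial.aeval z)) *
      (A.map (MvPolynomial.aeval z)).transpose).det =
        MvPolynomial.aeval z (A * A.transpose).det := fun z => by
    rw [AlgHom.map_det, AlgHom.mapMatrix_apply, Matrix.map_mul, Matrix.transpose_map]
  rw [linearIndependent_row_iff_det_mul_transpose_ne_zero, hdet] at hy ⊢
  exact fun h => hy (by rw [hx (h.trans (map_zero _).symm), map_zero])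

end Generic

section EdgeLength

/-- The squared length of the segment between the points indexed by `e.1` and `e.2`. -/
noncomputable def sqLength (e : ι × ι) (q : Cfg ι d) : ℝ := ‖q e.2 - q e.1‖ ^ 2

theorem contDiff_sqLength (e : ι × ι) : ContDiff ℝ 1 (sqLength (d := d) e) := by
  unfold sqLength
  exact ContDiff.norm_sq ℝ (by fun_prop)

theorem fderiv_sqLength_apply (e : ι × ι) (q u : Cfg ι d) :
    fderiv ℝ (sqLength e) q u = 2 * ⟪q e.2 - q e.1, u e.2 - u e.1⟫ := by
  have h := ((hasFDerivAt_apply (𝕜 := ℝ) e.2 q).sub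
    (hasFDerivAt_apply (𝕜 := ℝ) e.1 q)).norm_sq
  change fderiv ℝ (fun q : Cfg ι d => ‖q e.2 - q e.1‖ ^ 2) q u = _
  rw [HasFDerivAt.fderiv (f := fun q : Cfg ι d => ‖q e.2 - q e.1‖ ^ 2) h]
  simp [inner_sub_left, inner_sub_right]

variable [DecidableEq ι]

/-- The matrix of partial derivatives of the squared lengths, as a matrix of polynomials in the
coordinates. -/
noncomputable def sqLengthJacobian {κ : Type*} (a : κ → ι × ι) :
    Matrix κ (ι × Fin d) (MvPolynomial (ι × Fin d) ℚ) :=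
  Matrix.of fun k vi => 2 * (MvPolynomial.X ((a k).2, vi.2) - MvPolynomial.X ((a k).1, vi.2)) *
    ((if (a k).2 = vi.1 then 1 else 0) - (if (a k).1 = vi.1 then 1 else 0))

/-- The values of a functional on the coordinate directions. -/
noncomputable def coordValues : (Cfg ι d →L[ℝ] ℝ) →ₗ[ℝ] (ι × Fin d → ℝ) where
  toFun L vi := L (Pi.single vi.1 (EuclideanSpace.single vi.2 1))
  map_add' _ _ := rfl
  map_smul' _ _ := rfl

theorem ker_coordValues : (coordValues (ι := ι) (d := d)).ker = ⊥ := by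
  refine LinearMap.ker_eq_bot'.2 fun L hL => ?_
  have : (L : Cfg ι d →ₗ[ℝ] ℝ) = 0 := by
    refine LinearMap.pi_ext' fun v => ?_
    refine (EuclideanSpace.basisFun (Fin d) ℝ).toBasis.ext fun i => ?_
    simpa [coordValues] using congrFun hL (v, i)
  exact ContinuousLinearMap.coe_injective this

theorem row_sqLengthJacobian_map_aeval {κ : Type*} (a : κ → ι × ι) (q : Cfg ι d) :
    ((sqLengthJacobian (d := d) a).map
      (MvPolynomial.aeval fun vi : ι × Fin d => q vi.1 vi.2)).row =
      coordValues ∘ fun k => fderiv ℝ (sqLength (a k)) q := by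
  ext k ⟨v, i⟩
  simp only [Matrix.row, Matrix.map_apply, sqLengthJacobian, Matrix.of_apply, Function.comp_apply,
    coordValues, LinearMap.coe_mk, AddHom.coe_mk, fderiv_sqLength_apply, Pi.single_apply]
  split_ifs <;> (simp [EuclideanSpace.inner_single_right, inner_sub_left]; try ring)

theorem Generic.linearIndependent_fderiv_sqLength {κ : Type*} [Finite κ] {p : Cfg ι d}
    (hp : Generic p) (a : κ → ι × ι) {q : Cfg ι d}
    (h : LinearIndependent ℝ fun k => fderiv ℝ (sqLength (a k)) q) :
    LinearIndependent ℝ fun k => fderiv ℝ (sqLength (a k)) p := by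
  cases nonempty_fintype κ
  rw [← coordValues.linearIndependent_iff ker_coordValues, ← row_sqLengthJacobian_map_aeval]
    at h ⊢
  exact linearIndependent_aeval_of_algebraicIndependent _ hp h

/-- Near a generic configuration the edge-length map has constant rank, so an infinitesimal motion
is tangent to a curve of equivalent frameworks. -/
theorem Generic.exists_curve {p : Cfg ι d} (hp : Generic p) (G : SimpleGraph ι) {u : Cfg ι d}
    (hu : IsInfMotion G p u) :
    ∃ γ : ℝ → Cfg ι d, γ 0 = p ∧ HasDerivAt γ u 0 ∧ ∃ ε > 0,
      ContinuousOn γ (Set.Ioo (-ε) ε) ∧ ∀ t ∈ Set.Ioo (-ε) ε, FrameworkEquiv G p (γ t) := by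
  let f : {e : ι × ι // G.Adj e.1 e.2} → Cfg ι d → ℝ := fun e => sqLength e.1
  obtain ⟨κ, a, ha, hspan, hind⟩ := exists_linearIndependent' ℝ (fun e => fderiv ℝ (f e) p)
  have : Finite κ := Finite.of_injective a ha
  have := Fintype.ofFinite κ
  have hf : ∀ e, ContDiff ℝ 1 (f e) := fun e => contDiff_sqLength e.1
  have hcont : Continuous fun q k => fderiv ℝ (f (a k)) q :=
    continuous_pi fun k => (hf (a k)).continuous_fderiv one_ne_zero
  obtain ⟨γ, h0, hγ, ε, hε, hc, hconst⟩ := exists_curve_of_fderiv_mem_span hf a hind (by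
    filter_upwards [hcont.continuousAt.eventually hind.eventually] with q hq e
    by_contra hmem
    let b : Option κ → ι × ι := fun o => (o.elim e a).1
    have hq' : LinearIndependent ℝ fun o => fderiv ℝ (sqLength (d := d) (b o)) q := by
      rw [linearIndependent_option]
      exact ⟨hq, hmem⟩
    have hp' := hp.linearIndependent_fderiv_sqLength b hq'
    rw [linearIndependent_option] at hp'
    refine hp'.2 ?_
    change fderiv ℝ (f e) p ∈ Submodule.span ℝ (Set.range ((fun e => fderiv ℝ (f e) p) ∘ a))
    rw [hspan]
    exact Submodule.subset_span ⟨e, rfl⟩) (u := u) fun e => by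
      rw [fderiv_sqLength_apply, hu _ _ e.2, mul_zero]
  refine ⟨γ, h0, hγ, ε, hε, hc, fun t ht i j hij => ?_⟩
  have h := hconst t ht ⟨(i, j), hij⟩
  rw [dist_eq_norm', dist_eq_norm']
  exact ((sq_eq_sq₀ (norm_nonneg _) (norm_nonneg _)).1 h).symm

end EdgeLength

section CompleteGraph

/-- At a generic configuration, at most `d` edge vectors out of a common vertex are linearly
independent. -/
theorem Generic.linearIndependent_sub {α m : Type*} [Fintype m] {p : Cfg α d} (hp : Generic p)
    (o : α) (τ : m ↪ {v : α // v ≠ o}) (σ : m ↪ Fin d) :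
    LinearIndependent ℝ fun k => p (τ k) - p o := by
  classical
  let A : Matrix m (Fin d) (MvPolynomial (α × Fin d) ℚ) :=
    Matrix.of fun k j => MvPolynomial.X ((τ k : α), j) - MvPolynomial.X (o, j)
  let e := (WithLp.linearEquiv 2 ℝ (Fin d → ℝ)).toLinearMap
  have hA : ∀ q : Cfg α d, (A.map (MvPolynomial.aeval fun vi : α × Fin d => q vi.1 vi.2)).row =
      e ∘ fun k => q (τ k) - q o := fun q => by
    ext k j
    simp [A, e]
  have he : e.ker = ⊥ := LinearEquiv.ker _
  have hinj : Function.Injective fun k => (τ k : α) := Subtype.val_injective.comp τ.injective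
  let q : Cfg α d := Function.extend (fun k => (τ k : α))
    (fun k => EuclideanSpace.basisFun (Fin d) ℝ (σ k)) 0
  have hq : (fun k => q (τ k) - q o) = fun k => EuclideanSpace.basisFun (Fin d) ℝ (σ k) := by
    ext1 k
    have h1 : q (τ k) = EuclideanSpace.basisFun (Fin d) ℝ (σ k) := hinj.extend_apply _ _ k
    have h2 : q o = 0 := Function.extend_apply' _ _ _ fun ⟨k, hk⟩ => (τ k).2 hk
    rw [h1, h2, sub_zero]
  rw [← e.linearIndependent_iff he, ← hA]
  refine linearIndependent_aeval_of_algebraicIndependent A hp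
    (y := fun vi : α × Fin d => q vi.1 vi.2) ?_
  rw [hA, e.linearIndependent_iff he, hq]
  exact (EuclideanSpace.basisFun (Fin d) ℝ).orthonormal.linearIndependent.comp σ σ.injective

/-- A generic configuration is affinely independent or affinely spanning. -/
theorem Generic.linearIndependent_or_span_eq_top {p : Cfg ι d} (hp : Generic p) (o : ι) :
    (LinearIndependent ℝ fun v : {v : ι // v ≠ o} => p v - p o) ∨
      Submodule.span ℝ (Set.range fun v => p v - p o) = ⊤ := by
  classical
  rcases le_total (Fintype.card {v : ι // v ≠ o}) (Fintype.card (Fin d)) with h | h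
  · obtain ⟨σ⟩ := Function.Embedding.nonempty_of_card_le h
    exact Or.inl (hp.linearIndependent_sub o (Function.Embedding.refl _) σ)
  · obtain ⟨τ⟩ := Function.Embedding.nonempty_of_card_le h
    have hτ := hp.linearIndependent_sub o τ (Function.Embedding.refl _)
    refine Or.inr (top_unique ?_)
    rw [← hτ.span_eq_top_of_card_eq_finrank' (by simp)]
    exact Submodule.span_mono (Set.range_subset_iff.2 fun k => ⟨τ k, rfl⟩)

variable {E : Type*} [NormedAddCommGroup E] [InnerProductSpace ℝ E] [FiniteDimensional ℝ E]

/-- A linear map which is skew on the span of some vectors agrees there with a skew-adjoint map. -/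
theorem exists_skewAdjoint_of_inner_add_inner_eq_zero {a b : ι → E} {S₀ : E →ₗ[ℝ] E}
    (hS₀ : ∀ v, S₀ (a v) = b v) (hab : ∀ v w, ⟪a v, b w⟫ + ⟪b v, a w⟫ = 0) :
    ∃ S ∈ skewAdjoint (E →L[ℝ] E), ∀ v, S (a v) = b v := by
  let W := Submodule.span ℝ (Set.range a)
  have hW : ∀ w ∈ W, ⟪S₀ w, w⟫ = 0 := fun w hw => by
    obtain ⟨c, rfl⟩ := (Submodule.mem_span_range_iff_exists_fun ℝ).1 hw
    have h : ∀ x y : E, ⟪x, y⟫ = ⟪y, x⟫ := fun x y => real_inner_comm y x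
    have hsum : ⟪∑ v, c v • a v, ∑ v, c v • b v⟫ + ⟪∑ v, c v • b v, ∑ v, c v • a v⟫ = 0 := by
      simp only [sum_inner, inner_sum, real_inner_smul_left, real_inner_smul_right,
        ← Finset.sum_add_distrib, ← mul_add, hab, mul_zero, Finset.sum_const_zero]
    rw [h (∑ v, c v • a v)] at hsum
    simp only [map_sum, map_smul, hS₀]
    linarith
  let P : E →L[ℝ] E := W.starProjection
  let A : E →L[ℝ] E := S₀.toContinuousLinearMap ∘L P
  let S : E →L[ℝ] E := A - A.adjoint ∘L (ContinuousLinearMap.id ℝ E - P)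
  have hPa : ∀ v, P (a v) = a v := fun v =>
    Submodule.starProjection_eq_self_iff.2 (Submodule.subset_span ⟨v, rfl⟩)
  have hS : ∀ x, ⟪S x, x⟫ = 0 := fun x => by
    have h1 : ⟪A x, P x⟫ = 0 := hW _ (Submodule.starProjection_apply_mem W x)
    have h2 : ⟪S x, x⟫ = ⟪A x, x⟫ - ⟪x - P x, A x⟫ := by
      simp [S, inner_sub_left, ContinuousLinearMap.adjoint_inner_left]
    rw [h2, real_inner_comm, ← inner_sub_left, sub_sub_cancel, real_inner_comm, h1]
  refine ⟨S, ?_, fun v => by simp [S, A, hPa, hS₀]⟩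
  rw [skewAdjoint.mem_iff, ContinuousLinearMap.star_eq_adjoint]
  refine ContinuousLinearMap.ext fun x => ext_inner_right ℝ fun y => ?_
  rw [ContinuousLinearMap.adjoint_inner_left, neg_apply, inner_neg_left]
  have h := hS (x + y)
  rw [map_add, inner_add_left, inner_add_right, inner_add_right, hS, hS,
    real_inner_comm x (S y)] at h
  linarith

/-- An infinitesimal motion of the complete graph at a generic configuration is trivial. -/
theorem Generic.isTrivialMotion {p u : Cfg ι d} (hp : Generic p)
    (hu : ∀ i j, ⟪p j - p i, u j - u i⟫ = 0) : IsTrivialMotion p u := by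
  rw [isTrivialMotion_iff_exists_toEuclideanCLM]
  rcases isEmpty_or_nonempty ι with _ | ⟨⟨o⟩⟩
  · exact ⟨0, 0, by simp, fun v => isEmptyElim v⟩
  have hab : ∀ i j, ⟪p i - p o, u j - u o⟫ + ⟪u i - u o, p j - p o⟫ = 0 := fun i j => by
    have h := hu i j
    rw [← sub_sub_sub_cancel_right (p j) (p i) (p o),
      ← sub_sub_sub_cancel_right (u j) (u i) (u o), inner_sub_left,
      inner_sub_right (p j - p o), inner_sub_right (p i - p o), hu o j, hu o i] at h
    rw [real_inner_comm (p j - p o)]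
    linarith
  have hrel : ∀ c : ι → ℝ, ∑ i, c i • (p i - p o) = 0 → ∑ i, c i • (u i - u o) = 0 := by
    intro c hc
    rcases hp.linearIndependent_or_span_eq_top o with h | h
    · classical
      have hsub : ∀ x : Cfg ι d, ∑ i, c i • (x i - x o) =
          ∑ i : {v // v ≠ o}, c i • (x i - x o) := fun x =>
        (Finset.sum_erase (f := fun i => c i • (x i - x o)) _ (by simp)).symm.trans
          (Finset.sum_subtype (Finset.univ.erase o) (by simp) _)
      rw [hsub] at hc ⊢
      have h0 := Fintype.linearIndependent_iff.1 h (fun i => c i) hc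
      simp [h0]
    · refine (Submodule.mem_bot ℝ).1 ?_
      rw [← Submodule.top_orthogonal_eq_bot, ← h, Submodule.mem_orthogonal]
      intro w hw
      obtain ⟨c', rfl⟩ := (Submodule.mem_span_range_iff_exists_fun ℝ).1 hw
      rw [sum_inner]
      refine Finset.sum_eq_zero fun j _ => ?_
      have hj : ⟪p j - p o, ∑ i, c i • (u i - u o)⟫ + ⟪u j - u o, ∑ i, c i • (p i - p o)⟫ = 0 := by
        simp only [inner_sum, real_inner_smul_right, ← Finset.sum_add_distrib, ← mul_add, hab,
          mul_zero, Finset.sum_const_zero]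
      rw [hc, inner_zero_right, add_zero] at hj
      rw [real_inner_smul_left, hj, mul_zero]
  obtain ⟨S₀, hS₀⟩ := exists_linearMap_of_relations _ _ hrel
  obtain ⟨S, hS, hSv⟩ := exists_skewAdjoint_of_inner_add_inner_eq_zero hS₀ hab
  obtain ⟨M, rfl⟩ := EquivLike.surjective (Matrix.toEuclideanCLM (𝕜 := ℝ) (n := Fin d)) S
  refine ⟨M, u o - Matrix.toEuclideanCLM (𝕜 := ℝ) M (p o), ?_, fun v => ?_⟩
  · apply EquivLike.injective (Matrix.toEuclideanCLM (𝕜 := ℝ) (n := Fin d))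
    rw [← Matrix.conjTranspose_eq_transpose_of_trivial, ← Matrix.star_eq_conjTranspose,
      map_star, skewAdjoint.mem_iff.1 hS, map_neg]
  · rw [add_sub_left_comm, ← map_sub, hSv]
    abel

end CompleteGraph

theorem Generic.flexible {G : SimpleGraph ι} {p : Cfg ι d} (hp : Generic p)
    (h : ¬ InfRigid G p) : Flexible G p := by
  classical
  simp only [InfRigid, not_forall] at h
  obtain ⟨u, hu, hnt⟩ := h
  obtain ⟨γ, h0, hγ, ε, hε, hc, hequiv⟩ := hp.exists_curve G hu
  have hmem : ∀ t ∈ Set.Ico (0 : ℝ) 1, ε * t ∈ Set.Ioo (-ε) ε := fun t ht =>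
    ⟨by nlinarith [ht.1], by nlinarith [ht.2]⟩
  refine ⟨fun t => γ (ε * t), ⟨hc.comp (by fun_prop) hmem, by simp [h0],
    fun t ht => hequiv _ (hmem t ht)⟩, ?_⟩
  by_contra! hcong
  refine hnt (hp.isTrivialMotion fun i j => ?_)
  have hcoord : ∀ v, HasDerivAt (fun t => γ t v) (u v) 0 := hasDerivAt_pi.1 hγ
  have hd := ((hcoord j).sub (hcoord i)).norm_sq.hasDerivWithinAt (s := Set.Ici 0)
  have hev : (fun t => ‖γ t j - γ t i‖ ^ 2) =ᶠ[nhdsWithin 0 (Set.Ici 0)]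
      fun _ => ‖p j - p i‖ ^ 2 := by
    filter_upwards [Ico_mem_nhdsGE hε] with t ht
    have hc := congruent_iff_forall_dist_eq.1
      (hcong (t / ε) ⟨div_nonneg ht.1 hε.le, (div_lt_one hε).2 ht.2⟩) j i
    rw [mul_div_cancel₀ _ hε.ne'] at hc
    rw [← dist_eq_norm, ← dist_eq_norm, hc]
  have hd' := (hasDerivWithinAt_const (0 : ℝ) (Set.Ici 0) (‖p j - p i‖ ^ 2)).congr_of_eventuallyEq
    hev (by rw [h0])
  have := (uniqueDiffWithinAt_Ici (0 : ℝ)).eq_deriv _ hd hd'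
  simpa [h0] using this

end AsimowRoth

/-- **Asimow–Roth.** If a framework `(G,p)` is infinitesimally rigid then it is rigid;
and if `(G,p)` is generic and infinitesimally flexible then it is flexible. -/
theorem asimow_roth {V : Type*} [Fintype V] [DecidableEq V] {d : ℕ}
    (G : SimpleGraph V) (p : Cfg V d) :
    (InfRigid G p → Rigid G p) ∧
      (Generic p → ¬ InfRigid G p → Flexible G p) := by
  exact ⟨InfRigid.rigid, Generic.flexible⟩

end CoordRigidity
end

section
/- A framework (G,p) in ℝ^d whose points affinely span ℝ^d is infinitesimally rigid if and only if it is statically rigid, i.e. every equilibrium load on (G,p) is resolvable by a stress. -/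
open scoped RealInnerProductSpace

namespace CoordRigidity

variable {V : Type*} [Fintype V] [DecidableEq V] {d k : ℕ}

/-- Configurations as a Euclidean space, with inner product `∑ v, ⟪f v, q v⟫`. -/
abbrev CfgL2 (V : Type*) [Fintype V] (d : ℕ) := PiLp 2 (fun _ : V => EuclideanSpace ℝ (Fin d))

/-- The linear map sending a stress to the load of its edge forces at each vertex. -/
noncomputable def stressForce {V : Type*} [Fintype V] {d : ℕ} (G : SimpleGraph V)
    [DecidableRel G.Adj] (p : Cfg V d) : (Sym2 V → ℝ) →ₗ[ℝ] CfgL2 V d where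
  toFun ρ := WithLp.toLp 2 fun i => ∑ j, if G.Adj i j then ρ s(i, j) • (p j - p i) else 0
  map_add' ρ σ := by
    ext1 i
    simp only [PiLp.add_apply, ← Finset.sum_add_distrib]
    refine Finset.sum_congr rfl fun j _ => ?_
    split_ifs <;> simp [add_smul]
  map_smul' c ρ := by
    ext1 i
    simp only [PiLp.smul_apply, Finset.smul_sum, RingHom.id_apply]
    refine Finset.sum_congr rfl fun j _ => ?_
    split_ifs <;> simp [mul_smul]

/-- The subspace of trivial infinitesimal motions. -/
def trivialMotions {V : Type*} [Fintype V] {d : ℕ} (p : Cfg V d) :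
    Submodule ℝ (CfgL2 V d) where
  carrier := {q | IsTrivialMotion p q}
  zero_mem' := ⟨0, 0, by simp, by simp⟩
  add_mem' := by
    rintro a b ⟨S, t, hS, h⟩ ⟨S', t', hS', h'⟩
    refine ⟨S + S', t + t', by rw [Matrix.transpose_add, hS, hS']; abel, fun v i => ?_⟩
    simp only [PiLp.add_apply, h, h', Matrix.add_apply, add_mul, Finset.sum_add_distrib,
      Pi.add_apply]
    ring
  smul_mem' := by
    rintro c a ⟨S, t, hS, h⟩
    refine ⟨c • S, c • t, by rw [Matrix.transpose_smul, hS, smul_neg], fun v i => ?_⟩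
    simp only [PiLp.smul_apply, h, Matrix.smul_apply, smul_eq_mul, Pi.smul_apply, mul_add,
      Finset.mul_sum, mul_assoc]

/-- Virtual work of the edge forces of a stress along `q`. -/
lemma two_mul_inner_stressForce {V : Type*} [Fintype V] {d : ℕ} (G : SimpleGraph V)
    [DecidableRel G.Adj] (p : Cfg V d) (ρ : Sym2 V → ℝ) (q : CfgL2 V d) :
    2 * ⟪stressForce G p ρ, q⟫ =
      -∑ i, ∑ j, if G.Adj i j then ρ s(i, j) * ⟪p j - p i, q j - q i⟫ else 0 := by
  have h : ⟪stressForce G p ρ, q⟫ =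
      ∑ i, ∑ j, if G.Adj i j then ρ s(i, j) * ⟪p j - p i, q i⟫ else 0 := by
    rw [PiLp.inner_apply]
    refine Finset.sum_congr rfl fun i _ => ?_
    simp only [stressForce, LinearMap.coe_mk, AddHom.coe_mk, sum_inner]
    refine Finset.sum_congr rfl fun j _ => ?_
    split_ifs
    · exact real_inner_smul_left _ _ _
    · exact inner_zero_left _
  have h' := h
  rw [Finset.sum_comm] at h'
  rw [two_mul]
  nth_rw 1 [h]
  rw [h', ← Finset.sum_add_distrib, ← Finset.sum_neg_distrib]
  refine Finset.sum_congr rfl fun i _ => ?_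
  rw [← Finset.sum_add_distrib, ← Finset.sum_neg_distrib]
  refine Finset.sum_congr rfl fun j _ => ?_
  simp only [G.adj_comm j i, Sym2.eq_swap (a := j) (b := i)]
  split_ifs
  · simp only [inner_sub_left, inner_sub_right]
    ring
  · simp

lemma mem_orthogonal_range_stressForce_iff {V : Type*} [Fintype V] {d : ℕ} (G : SimpleGraph V)
    [DecidableRel G.Adj] (p : Cfg V d) (q : CfgL2 V d) :
    q ∈ (LinearMap.range (stressForce G p))ᗮ ↔ IsInfMotion G p q := by
  constructor
  · intro hq
    let ρ : Sym2 V → ℝ := Sym2.lift ⟨fun i j => ⟪p j - p i, q j - q i⟫, fun i j => by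
      dsimp only
      rw [← neg_sub (p i) (p j), ← neg_sub (q i) (q j), inner_neg_neg]⟩
    have h := two_mul_inner_stressForce G p ρ q
    rw [hq _ ⟨ρ, rfl⟩, mul_zero, zero_eq_neg] at h
    have hpos : ∀ i j,
        0 ≤ if G.Adj i j then ρ s(i, j) * ⟪p j - p i, q j - q i⟫ else 0 := by
      intro i j
      split_ifs
      · exact mul_self_nonneg _
      · exact le_rfl
    intro i j hij
    have h1 := (Finset.sum_eq_zero_iff_of_nonneg
      fun i _ => Finset.sum_nonneg fun j _ => hpos i j).1 h i (Finset.mem_univ i)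
    have h2 := (Finset.sum_eq_zero_iff_of_nonneg fun j _ => hpos i j).1 h1 j (Finset.mem_univ j)
    rw [if_pos hij] at h2
    exact mul_self_eq_zero.1 h2
  · rintro hq _ ⟨ρ, rfl⟩
    have h := two_mul_inner_stressForce G p ρ q
    rw [Finset.sum_eq_zero fun i _ => Finset.sum_eq_zero fun j _ => ?_] at h
    · linarith
    · split_ifs with hij
      · rw [hq i j hij, mul_zero]
      · rfl

/-- Work of a load along the trivial motion given by `S` and `t`. -/
lemma inner_eq_of_affine {V : Type*} [Fintype V] {d : ℕ} (p : Cfg V d)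
    (S : Matrix (Fin d) (Fin d) ℝ) (t : Fin d → ℝ) (q f : CfgL2 V d)
    (h : ∀ v i, q v i = (∑ j, S i j * p v j) + t i) :
    ⟪q, f⟫ = (∑ i, ∑ j, S i j * ∑ v, f v i * p v j) + ∑ i, t i * ∑ v, f v i := by
  simp only [PiLp.inner_apply, h, RCLike.inner_apply, conj_trivial, mul_add,
    Finset.sum_add_distrib, Finset.mul_sum]
  congr 1
  · rw [Finset.sum_comm]
    refine Finset.sum_congr rfl fun i _ => ?_
    rw [Finset.sum_comm]
    refine Finset.sum_congr rfl fun j _ => Finset.sum_congr rfl fun v _ => by ring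
  · rw [Finset.sum_comm]
    refine Finset.sum_congr rfl fun i _ => Finset.sum_congr rfl fun v _ => by ring

lemma mem_orthogonal_trivialMotions_iff {V : Type*} [Fintype V] {d : ℕ} (p : Cfg V d)
    (f : CfgL2 V d) :
    f ∈ (trivialMotions p)ᗮ ↔ IsEquilibriumLoad p f := by
  constructor
  · intro hf
    have work : ∀ (S : Matrix (Fin d) (Fin d) ℝ) (t : Fin d → ℝ), S.transpose = -S →
        (∑ i, ∑ j, S i j * ∑ v, f v i * p v j) + ∑ i, t i * ∑ v, f v i = 0 := by
      intro S t hS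
      let q : CfgL2 V d :=
        WithLp.toLp 2 fun v => WithLp.toLp 2 fun i => (∑ j, S i j * p v j) + t i
      rw [← inner_eq_of_affine p S t q f fun _ _ => rfl]
      exact hf q ⟨S, t, hS, fun _ _ => rfl⟩
    refine ⟨?_, fun j k _ => ?_⟩
    · ext i
      simpa [Pi.single_apply] using work 0 (Pi.single i 1) (by simp)
    · have h := work (Matrix.single j k 1 - Matrix.single k j 1) 0 (by simp)
      simpa [Matrix.single_apply, sub_mul, Finset.sum_sub_distrib, ite_and] using h
  · rintro ⟨hforce, htorque⟩ q ⟨S, t, hS, h⟩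
    rw [inner_eq_of_affine p S t q f h]
    have hsum : ∀ i, ∑ v, f v i = 0 := fun i => by
      simpa using congrArg (fun x : EuclideanSpace ℝ (Fin d) => x i) hforce
    have hsymm : ∀ j k, ∑ v, f v j * p v k = ∑ v, f v k * p v j := by
      have hlt : ∀ j k, j < k → ∑ v, f v j * p v k = ∑ v, f v k * p v j := fun j k hjk => by
        rw [← sub_eq_zero, ← Finset.sum_sub_distrib]
        exact htorque j k hjk
      intro j k
      rcases lt_trichotomy j k with hjk | rfl | hjk
      · exact hlt j k hjk
      · rfl
      · exact (hlt k j hjk).symm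
    have hskew : ∀ i j, S j i = -S i j := fun i j => congrFun (congrFun hS i) j
    have hneg : (∑ i, ∑ j, S i j * ∑ v, f v i * p v j) =
        -∑ i, ∑ j, S i j * ∑ v, f v i * p v j := by
      conv_lhs => rw [Finset.sum_comm]
      simp only [← Finset.sum_neg_distrib]
      refine Finset.sum_congr rfl fun i _ => Finset.sum_congr rfl fun j _ => ?_
      rw [hskew i j, hsymm j i, neg_mul]
    simp only [hsum, mul_zero, Finset.sum_const_zero, add_zero]
    linarith

lemma exists_resolves_iff {V : Type*} [Fintype V] {d : ℕ} (G : SimpleGraph V)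
    [DecidableRel G.Adj] (p : Cfg V d) (f : CfgL2 V d) :
    (∃ ρ, Resolves G p ρ f) ↔ f ∈ LinearMap.range (stressForce G p) := by
  rw [← Submodule.neg_mem_iff]
  refine exists_congr fun ρ => ⟨fun h => ?_, fun h i => ?_⟩
  · ext1 i
    exact h i
  · exact congrArg (fun x : CfgL2 V d => x i) h

/-- A framework in `ℝ^d` whose points affinely span `ℝ^d` is infinitesimally rigid
if and only if it is statically rigid, i.e. every equilibrium load is resolvable
by a stress. -/
theorem inf_rigid_iff_statically_rigid {V : Type*} [Fintype V] [DecidableEq V] {d : ℕ}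
    (G : SimpleGraph V) [DecidableRel G.Adj] (p : Cfg V d)
    (hspan : affineSpan ℝ (Set.range p) = ⊤) :
    InfRigid G p ↔
      ∀ f : Cfg V d, IsEquilibriumLoad p f → ∃ ρ : Sym2 V → ℝ, Resolves G p ρ f := by
  have motions : InfRigid G p ↔ (LinearMap.range (stressForce G p))ᗮ ≤ trivialMotions p :=
    ⟨fun h q hq => h q ((mem_orthogonal_range_stressForce_iff G p q).1 hq),
      fun h q hq => h ((mem_orthogonal_range_stressForce_iff G p (WithLp.toLp 2 q)).2 hq)⟩
  have loads : (∀ f : Cfg V d, IsEquilibriumLoad p f → ∃ ρ : Sym2 V → ℝ, Resolves G p ρ f) ↔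
      (trivialMotions p)ᗮ ≤ LinearMap.range (stressForce G p) :=
    ⟨fun h f hf => (exists_resolves_iff G p f).1
        (h f ((mem_orthogonal_trivialMotions_iff p f).1 hf)),
      fun h f hf => (exists_resolves_iff G p (WithLp.toLp 2 f)).2
        (h ((mem_orthogonal_trivialMotions_iff p (WithLp.toLp 2 f)).2 hf))⟩
  rw [motions, loads]
  constructor <;> intro h
  · simpa only [Submodule.orthogonal_orthogonal] using Submodule.orthogonal_le h
  · simpa only [Submodule.orthogonal_orthogonal] using Submodule.orthogonal_le h

end CoordRigidity
end
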